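/- Let D be a connected C-homogeneous triangle-free digraph with more than one end whose underlying graph is not a tree, let 𝒞 be a basic cut system of D, let S be a 𝒞-separator and s ∈ S. Then there is exactly one 𝒞-block that contains s together with all out-neighbours of s, and exactly one 𝒞-block that contains s together with all in-neighbours of s; furthermore s has more than one out-neighbour and more than one in-neighbour. -/

import Mathlib

open Set

universe u

/-- The underlying undirected graph of a digraph given by its edge relation. -/
def UG {V : Type u} (E : V → V → Prop) : SimpleGraph V := SimpleGraph.fromRel E

/-- `E` is a digraph edge relation: irreflexive and antisymmetric. -/
def IsDigraph {V : Type u} (E : V → V → Prop) : Prop :=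
  (∀ x, ¬ E x x) ∧ ∀ x y, E x y → ¬ E y x

/-- A ray in a graph: a one-way infinite path. -/
def IsRay {V : Type u} (G : SimpleGraph V) (r : ℕ → V) : Prop :=
  Function.Injective r ∧ ∀ n, G.Adj (r n) (r (n + 1))

/-- A sequence is eventually in a set. -/
def EventuallyIn {V : Type u} (r : ℕ → V) (C : Set V) : Prop :=
  ∃ N, ∀ n, N ≤ n → r n ∈ C

/-- `C` is a connected component of the subgraph of `G` induced on `W`:
a maximal connected subset of `W`. -/
def IsCompOf {V : Type u} (G : SimpleGraph V) (C W : Set V) : Prop :=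
  C.Nonempty ∧ C ⊆ W ∧ (G.induce C).Connected ∧
    ∀ C', C ⊆ C' → C' ⊆ W → (G.induce C').Connected → C' = C

/-- Two rays are equivalent if for every finite vertex set `S` they lie eventually
in the same component of the graph minus `S`. -/
def RayEquiv {V : Type u} (G : SimpleGraph V) (r r' : ℕ → V) : Prop :=
  ∀ S : Finset V, ∃ C : Set V, IsCompOf G C {v | v ∉ S} ∧
    EventuallyIn r C ∧ EventuallyIn r' C

/-- The graph has more than one end: two inequivalent rays. -/
def MoreThanOneEnd {V : Type u} (G : SimpleGraph V) : Prop :=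
  ∃ r r' : ℕ → V, IsRay G r ∧ IsRay G r' ∧ ¬ RayEquiv G r r'

/-- The graph has infinitely many ends: arbitrarily large families of pairwise
inequivalent rays. -/
def InfinitelyManyEnds {V : Type u} (G : SimpleGraph V) : Prop :=
  ∀ n : ℕ, ∃ f : Fin n → (ℕ → V), (∀ i, IsRay G (f i)) ∧
    ∀ i j, i ≠ j → ¬ RayEquiv G (f i) (f j)

/-- A separation of a graph: a pair of vertex sets covering `V` such that every
edge lies within one side. -/
def IsSeparation {V : Type u} (G : SimpleGraph V) (c : Set V × Set V) : Prop :=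
  c.1 ∪ c.2 = univ ∧ ∀ x y, G.Adj x y → (x ∈ c.1 ∧ y ∈ c.1) ∨ (x ∈ c.2 ∧ y ∈ c.2)

/-- The order of a separation: the number of vertices in its separator. -/
noncomputable def sepOrder {V : Type u} (c : Set V × Set V) : ℕ := (c.1 ∩ c.2).ncard

/-- The neighbourhood of a vertex set. -/
def Nbhd {V : Type u} (G : SimpleGraph V) (A : Set V) : Set V :=
  {v | v ∉ A ∧ ∃ u ∈ A, G.Adj u v}

/-- The separation `(A, ∼)`. -/
def tildeSep {V : Type u} (G : SimpleGraph V) (A : Set V) : Set V × Set V :=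
  (A, Aᶜ ∪ Nbhd G Aᶜ)

/-- `S` separates the wings of the separation `c`: every walk from one wing to
the other meets `S`. -/
def SeparatesWings {V : Type u} (G : SimpleGraph V) (c : Set V × Set V) (S : Set V) : Prop :=
  ∀ a ∈ c.1 \ c.2, ∀ b ∈ c.2 \ c.1, ∀ w : G.Walk a b, ∃ v ∈ w.support, v ∈ S

/-- A separation of finite order with non-empty wings is essential if its first wing is
connected and no proper subset of the separator separates the wings. -/
def IsEssential {V : Type u} (G : SimpleGraph V) (c : Set V × Set V) : Prop :=
  IsSeparation G c ∧ (c.1 ∩ c.2).Finite ∧ (c.1 \ c.2).Nonempty ∧ (c.2 \ c.1).Nonempty ∧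
  (G.induce (c.1 \ c.2)).Connected ∧
  ∀ S, S ⊂ c.1 ∩ c.2 → ¬ SeparatesWings G c S

/-- `C` is a wing of some separation in `𝒞`. -/
def IsWingOf {V : Type u} (𝒞 : Set (Set V × Set V)) (C : Set V) : Prop :=
  ∃ d ∈ 𝒞, C = d.1 \ d.2 ∨ C = d.2 \ d.1

/-- A cut system. -/
def IsCutSystem {V : Type u} (G : SimpleGraph V) (𝒞 : Set (Set V × Set V)) : Prop :=
  𝒞.Nonempty ∧ (∀ c ∈ 𝒞, IsEssential G c) ∧
  (∀ c ∈ 𝒞, ∃ d ∈ 𝒞, d.1 ⊆ c.2) ∧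
  (∀ c ∈ 𝒞, ∀ C : Set V, IsCompOf G C (c.2 \ c.1) →
    (∃ d ∈ 𝒞, d.1 \ d.2 ⊆ C) → tildeSep G (C ∪ Nbhd G C) ∈ 𝒞) ∧
  (∀ c ∈ 𝒞, ∀ c' ∈ 𝒞, ∃ C₁ C₂ : Set V,
    ((IsCompOf G C₁ ((c.1 \ c.2) ∩ (c'.1 \ c'.2)) ∧
      IsCompOf G C₂ ((c.2 \ c.1) ∩ (c'.2 \ c'.1))) ∨
     (IsCompOf G C₁ ((c.2 \ c.1) ∩ (c'.1 \ c'.2)) ∧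
      IsCompOf G C₂ ((c.1 \ c.2) ∩ (c'.2 \ c'.1)))) ∧
    IsWingOf 𝒞 C₁ ∧ IsWingOf 𝒞 C₂)

/-- Pick a side of a separation. -/
def pickSide {V : Type u} (c : Set V × Set V) : Bool → Set V
  | false => c.1
  | true => c.2

/-- Two cuts are nested (with respect to the cut system `𝒞`). -/
def NestedPair {V : Type u} (G : SimpleGraph V) (𝒞 : Set (Set V × Set V))
    (c d : Set V × Set V) : Prop :=
  ∃ i j : Bool,
    ((¬ ∃ C, IsCompOf G C ((tildeSep G (pickSide c i ∩ pickSide d j)).1 \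
        (tildeSep G (pickSide c i ∩ pickSide d j)).2) ∧
        tildeSep G (C ∪ Nbhd G C) ∈ 𝒞) ∨
     (¬ ∃ C, IsCompOf G C ((tildeSep G (pickSide c i ∩ pickSide d j)).2 \
        (tildeSep G (pickSide c i ∩ pickSide d j)).1) ∧
        tildeSep G (C ∪ Nbhd G C) ∈ 𝒞)) ∧
    (c.1 ∩ c.2) ∪ (d.1 ∩ d.2) ⊆ pickSide c (!i) ∩ pickSide d (!j)

/-- A cut system is nested if each two of its cuts are nested. -/
def IsNestedSystem {V : Type u} (G : SimpleGraph V) (𝒞 : Set (Set V × Set V)) : Prop :=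
  ∀ c ∈ 𝒞, ∀ d ∈ 𝒞, NestedPair G 𝒞 c d

/-- `S` is a `𝒞`-separator. -/
def IsSeparatorOf {V : Type u} (𝒞 : Set (Set V × Set V)) (S : Set V) : Prop :=
  ∃ c ∈ 𝒞, c.1 ∩ c.2 = S

/-- A vertex set contains an end: some ray lies in it. -/
def ContainsEnd {V : Type u} (G : SimpleGraph V) (A : Set V) : Prop :=
  ∃ r : ℕ → V, IsRay G r ∧ ∀ n, r n ∈ A

/-- A basic cut system. -/
def IsBasic {V : Type u} (G : SimpleGraph V) (𝒞 : Set (Set V × Set V)) : Prop :=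
  IsCutSystem G 𝒞 ∧
  (∀ c ∈ 𝒞, ∀ d ∈ 𝒞, ¬ sepOrder c < sepOrder d) ∧
  IsNestedSystem G 𝒞 ∧
  (∀ φ : G ≃g G, ∀ c ∈ 𝒞, ((⇑φ '' c.1, ⇑φ '' c.2) : Set V × Set V) ∈ 𝒞) ∧
  (∀ S S' : Set V, IsSeparatorOf 𝒞 S → IsSeparatorOf 𝒞 S' → ∃ φ : G ≃g G, ⇑φ '' S = S') ∧
  (∀ c ∈ 𝒞, ContainsEnd G c.1 ∧ ContainsEnd G c.2 ∧
    ¬ ∃ d : Set V × Set V, IsSeparation G d ∧ (d.1 ∩ d.2).Finite ∧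
      (d.1 ∩ d.2).ncard < sepOrder c ∧ ContainsEnd G d.1 ∧ ContainsEnd G d.2)

/-- The defining property of a `𝒞`-block. -/
def BlockProp {V : Type u} (𝒞 : Set (Set V × Set V)) (X : Set V) : Prop :=
  (∀ c ∈ 𝒞, (X ⊆ c.1 ∨ X ⊆ c.2) ∧ ¬ (X ⊆ c.1 ∧ X ⊆ c.2)) ∧
  ∃ c ∈ 𝒞, X ⊆ c.1 ∧ c.1 ∩ c.2 ⊆ X

/-- A `𝒞`-block: a maximal vertex set with the block property. -/
def IsCBlock {V : Type u} (𝒞 : Set (Set V × Set V)) (X : Set V) : Prop :=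
  BlockProp 𝒞 X ∧ ∀ X', X ⊆ X' → BlockProp 𝒞 X' → X' = X

/-- A digraph is C-homogeneous: every isomorphism between finite induced
subdigraphs with connected underlying graphs extends to an automorphism. -/
def DigraphCHom {V : Type u} (E : V → V → Prop) : Prop :=
  ∀ (X Y : Set V), X.Finite → Y.Finite → ((UG E).induce X).Connected →
  ∀ φ : X ≃ Y, (∀ a b : X, E a.1 b.1 ↔ E (φ a).1 (φ b).1) →
  ∃ ψ : Equiv.Perm V, (∀ x y, E (ψ x) (ψ y) ↔ E x y) ∧ ∀ a : X, ψ a.1 = (φ a).1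

/-- A graph is C-homogeneous: every isomorphism between finite connected induced
subgraphs extends to an automorphism. -/
def GraphCHom {V : Type u} (G : SimpleGraph V) : Prop :=
  ∀ (X Y : Set V), X.Finite → Y.Finite → (G.induce X).Connected →
  ∀ φ : X ≃ Y, (∀ a b : X, G.Adj a.1 b.1 ↔ G.Adj (φ a).1 (φ b).1) →
  ∃ ψ : G ≃g G, ∀ a : X, ψ a.1 = (φ a).1

/-- The digraph contains a triangle: three pairwise adjacent vertices. -/
def HasTriangle {V : Type u} (E : V → V → Prop) : Prop :=
  ∃ x y z : V, (UG E).Adj x y ∧ (UG E).Adj y z ∧ (UG E).Adj x z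

/-- An `n`-arc: a directed path `p 0, p 1, …, p n`. -/
def IsArc {V : Type u} (E : V → V → Prop) (n : ℕ) (p : ℕ → V) : Prop :=
  (∀ i j, i ≤ n → j ≤ n → p i = p j → i = j) ∧ ∀ i < n, E (p i) (p (i + 1))

/-- A digraph is highly-arc-transitive: for every `n`, its automorphism group acts
transitively on `n`-arcs. -/
def HighlyArcTransitive {V : Type u} (E : V → V → Prop) : Prop :=
  ∀ n : ℕ, ∀ p q : ℕ → V, IsArc E n p → IsArc E n q →
  ∃ ψ : Equiv.Perm V, (∀ x y, E (ψ x) (ψ y) ↔ E x y) ∧ ∀ i ≤ n, ψ (p i) = q i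

/-- An alternating walk `w 0, …, w n` in a digraph. -/
def IsAltWalk {V : Type u} (E : V → V → Prop) (n : ℕ) (w : ℕ → V) : Prop :=
  (∀ i < n, E (w i) (w (i + 1)) ∨ E (w (i + 1)) (w i)) ∧
  ∀ i, i + 2 ≤ n → (E (w i) (w (i + 1)) ↔ E (w (i + 2)) (w (i + 1)))

/-- The edge `e` lies on the walk `w 0, …, w n` (in either direction). -/
def EdgeOnWalk {V : Type u} (n : ℕ) (w : ℕ → V) (e : V × V) : Prop :=
  ∃ i < n, (w i = e.1 ∧ w (i + 1) = e.2) ∨ (w i = e.2 ∧ w (i + 1) = e.1)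

/-- Two edges are reachable from each other: they lie on a common alternating walk. -/
def Reach {V : Type u} (E : V → V → Prop) (e f : V × V) : Prop :=
  ∃ n w, IsAltWalk E n w ∧ EdgeOnWalk n w e ∧ EdgeOnWalk n w f

/-- The edge relation of the reachability digraph `Δ_e`. -/
def DeltaRel {V : Type u} (E : V → V → Prop) (e : V × V) : V → V → Prop :=
  fun x y => E x y ∧ Reach E e (x, y)

/-- The underlying undirected graph of the reachability digraph `Δ_e`. -/
def DeltaGraph {V : Type u} (E : V → V → Prop) (e : V × V) : SimpleGraph V :=
  UG (DeltaRel E e)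

/-- Tails of edges of `𝒜(e)`. -/
def Tails {V : Type u} (E : V → V → Prop) (e : V × V) : Set V :=
  {x | ∃ y, DeltaRel E e x y}

/-- Heads of edges of `𝒜(e)`. -/
def Heads {V : Type u} (E : V → V → Prop) (e : V × V) : Set V :=
  {y | ∃ x, DeltaRel E e x y}

/-- The set of descendants of a vertex. -/
def Descendants {V : Type u} (E : V → V → Prop) (x : V) : Set V :=
  {y | ∃ n p, IsArc E n p ∧ p 0 = x ∧ p n = y}

/-- `(X, Y)` is a bipartition of the graph `G`. -/
def IsBipartition {V : Type u} (G : SimpleGraph V) (X Y : Set V) : Prop :=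
  X ∪ Y = univ ∧ Disjoint X Y ∧
  ∀ a b, G.Adj a b → (a ∈ X ∧ b ∈ Y) ∨ (a ∈ Y ∧ b ∈ X)

/-- `G` with sides `X`, `Y` is C-homogeneous bipartite: every isomorphism between
finite connected induced subgraphs preserving the sides extends to a side-preserving
automorphism. -/
def BipCHom {V : Type u} (G : SimpleGraph V) (X Y : Set V) : Prop :=
  ∀ (A B : Set V), A.Finite → B.Finite → (G.induce A).Connected →
  ∀ φ : A ≃ B, (∀ a b : A, G.Adj a.1 b.1 ↔ G.Adj (φ a).1 (φ b).1) →
  (∀ a : A, a.1 ∈ X ↔ (φ a).1 ∈ X) → (∀ a : A, a.1 ∈ Y ↔ (φ a).1 ∈ Y) →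
  ∃ ψ : G ≃g G, (∀ v, v ∈ X ↔ ψ v ∈ X) ∧ (∀ v, v ∈ Y ↔ ψ v ∈ Y) ∧
    ∀ a : A, ψ a.1 = (φ a).1

/-- `G` with sides `X`, `Y` is homogeneous bipartite: every isomorphism between
finite induced subgraphs preserving the sides extends to a side-preserving
automorphism. -/
def BipHom {V : Type u} (G : SimpleGraph V) (X Y : Set V) : Prop :=
  ∀ (A B : Set V), A.Finite → B.Finite →
  ∀ φ : A ≃ B, (∀ a b : A, G.Adj a.1 b.1 ↔ G.Adj (φ a).1 (φ b).1) →
  (∀ a : A, a.1 ∈ X ↔ (φ a).1 ∈ X) → (∀ a : A, a.1 ∈ Y ↔ (φ a).1 ∈ Y) →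
  ∃ ψ : G ≃g G, (∀ v, v ∈ X ↔ ψ v ∈ X) ∧ (∀ v, v ∈ Y ↔ ψ v ∈ Y) ∧
    ∀ a : A, ψ a.1 = (φ a).1

/-- `G` with sides `X`, `Y` is generic bipartite. -/
def GenericBip {V : Type u} (G : SimpleGraph V) (X Y : Set V) : Prop :=
  (∀ U W : Set V, U ⊆ X → W ⊆ X → U.Finite → W.Finite → Disjoint U W →
    ∃ v ∈ Y, (∀ u ∈ U, G.Adj v u) ∧ ∀ w ∈ W, ¬ G.Adj v w) ∧
  (∀ U W : Set V, U ⊆ Y → W ⊆ Y → U.Finite → W.Finite → Disjoint U W →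
    ∃ v ∈ X, (∀ u ∈ U, G.Adj v u) ∧ ∀ w ∈ W, ¬ G.Adj v w)

/-- `v` can be reached from `u` by a path avoiding `S`. -/
def ReachOff {V : Type u} (G : SimpleGraph V) (S : Set V) (u v : V) : Prop :=
  u ∉ S ∧ Relation.ReflTransGen (fun a b => G.Adj a b ∧ b ∉ S) u v

/-- The component of `u` in `G - S` (empty if `u ∈ S`). -/
def Cmp {V : Type u} (G : SimpleGraph V) (S : Set V) (u : V) : Set V :=
  {v | ReachOff G S u v}

section ReachOff

variable {V : Type u} {G : SimpleGraph V} {S T : Set V} {u v w : V}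

theorem ReachOff.refl (h : u ∉ S) : ReachOff G S u u := ⟨h, .refl⟩

theorem ReachOff.trans (h₁ : ReachOff G S u v) (h₂ : ReachOff G S v w) : ReachOff G S u w :=
  ⟨h₁.1, h₁.2.trans h₂.2⟩

theorem ReachOff.notMem_right (h : ReachOff G S u v) : v ∉ S := by
  obtain ⟨h₁, h₂⟩ := h
  cases h₂ with
  | refl => exact h₁
  | tail _ h => exact h.2

theorem ReachOff.of_adj (h : G.Adj u v) (hu : u ∉ S) (hv : v ∉ S) : ReachOff G S u v :=
  ⟨hu, .single ⟨h, hv⟩⟩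

theorem ReachOff.symm (h : ReachOff G S u v) : ReachOff G S v u := by
  obtain ⟨h₁, h₂⟩ := h
  induction h₂ with
  | refl => exact .refl h₁
  | @tail b c hb hc ih =>
    have hbS : b ∉ S := ReachOff.notMem_right ⟨h₁, hb⟩
    exact (ReachOff.of_adj hc.1.symm hc.2 hbS).trans ih

/-- A set closed under adjacency outside `S` is closed under reachability off `S`. -/
theorem ReachOff.mem_of_closed {A : Set V} (h : ReachOff G S u v) (hu : u ∈ A)
    (hA : ∀ a b, a ∈ A → G.Adj a b → b ∉ S → b ∈ A) : v ∈ A := by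
  obtain ⟨-, h₂⟩ := h
  induction h₂ with
  | refl => exact hu
  | tail _ hc ih => exact hA _ _ ih hc.1 hc.2

theorem ReachOff.of_cmp_inter (h : ReachOff G S u v) (hT : ∀ w ∈ Cmp G S u, w ∉ T) :
    ReachOff G T u v := by
  obtain ⟨h₁, h₂⟩ := h
  induction h₂ with
  | refl => exact .refl (hT _ (.refl h₁))
  | @tail b c hb hc ih =>
    exact ih.trans (.of_adj hc.1 ih.notMem_right (hT _ ⟨h₁, hb.tail hc⟩))

/-- Reachability off a set is witnessed by a finite vertex set. -/
theorem ReachOff.exists_finite (h : ReachOff G S u v) :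
    ∃ F : Set V, F.Finite ∧ (∀ w ∈ F, w ∉ S) ∧
      ∀ T : Set V, (∀ w ∈ F, w ∉ T) → ReachOff G T u v := by
  obtain ⟨h₁, h₂⟩ := h
  induction h₂ with
  | refl => exact ⟨{u}, finite_singleton u, by simpa using h₁, fun T hT => .refl (hT u rfl)⟩
  | @tail b c hb hc ih =>
    obtain ⟨F, hF, hFS, hFT⟩ := ih
    refine ⟨insert c F, hF.insert c, ?_, fun T hT => ?_⟩
    · rintro w (rfl | hw)
      exacts [hc.2, hFS w hw]
    · have := hFT T fun w hw => hT w (mem_insert_of_mem _ hw)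
      exact this.trans (.of_adj hc.1 this.notMem_right (hT c (mem_insert _ _)))

theorem ReachOff.map (φ : G ≃g G) (h : ReachOff G S u v) :
    ReachOff G (φ '' S) (φ u) (φ v) := by
  have key : ∀ w, w ∉ S → φ w ∉ φ '' S := by
    rintro w hw ⟨x, hx, hxw⟩
    exact hw (φ.injective hxw ▸ hx)
  obtain ⟨h₁, h₂⟩ := h
  induction h₂ with
  | refl => exact .refl (key _ h₁)
  | @tail b c hb hc ih =>
    exact ih.trans (.of_adj (φ.map_adj_iff.2 hc.1) ih.notMem_right (key _ hc.2))

theorem image_cmp (φ : G ≃g G) : φ '' Cmp G S u = Cmp G (φ '' S) (φ u) := by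
  ext w
  constructor
  · rintro ⟨v, hv, rfl⟩
    exact ReachOff.map φ hv
  · intro hw
    refine ⟨φ.symm w, ?_, φ.apply_symm_apply w⟩
    have := ReachOff.map φ.symm hw
    rw [← image_comp] at this
    change ReachOff G S u (φ.symm w)
    simpa [Function.comp_def] using this

theorem cmp_eq_of_mem (h : v ∈ Cmp G S u) : Cmp G S v = Cmp G S u := by
  ext w
  exact ⟨fun hw => ReachOff.trans h hw, fun hw => ReachOff.trans (ReachOff.symm h) hw⟩

theorem notMem_of_mem_cmp (h : v ∈ Cmp G S u) : v ∉ S := ReachOff.notMem_right h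

theorem mem_cmp_of_adj (h : v ∈ Cmp G S u) (ha : G.Adj v w) (hw : w ∉ S) : w ∈ Cmp G S u :=
  ReachOff.trans h (.of_adj ha (ReachOff.notMem_right h) hw)

theorem mem_cmp_self (h : u ∉ S) : u ∈ Cmp G S u := .refl h

/-- If a component of `G - S` avoids `T`, it lies in a component of `G - T`. -/
theorem cmp_subset_cmp (hT : ∀ w ∈ T, w ∉ Cmp G S u) : Cmp G S u ⊆ Cmp G T u :=
  fun _ hv => ReachOff.of_cmp_inter hv fun w hw hwT => hT w hwT hw

end ReachOff

/-- The combinatorial properties of the separators of a basic cut system: they are nested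
vertex sets of the same finite size, every component of their complement is attached to all of
the separator, they cover the graph, and they are of minimal size in a weak sense. -/
structure SepSystem {V : Type u} (G : SimpleGraph V) (𝒮 : Set (Set V)) : Prop where
  finite : ∀ S ∈ 𝒮, S.Finite
  ncard_eq : ∀ S ∈ 𝒮, ∀ S' ∈ 𝒮, S.ncard = S'.ncard
  full : ∀ S ∈ 𝒮, ∀ u, u ∉ S → ∀ t ∈ S, ∃ v ∈ Cmp G S u, G.Adj t v
  exists_far : ∀ S ∈ 𝒮, ∀ u, ∃ w, w ∉ S ∧ w ∉ Cmp G S u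
  nested : ∀ S ∈ 𝒮, ∀ S' ∈ 𝒮, ∀ a ∈ S', ∀ b ∈ S', a ∉ S → b ∉ S → ReachOff G S a b
  image_mem : ∀ φ : G ≃g G, ∀ S ∈ 𝒮, φ '' S ∈ 𝒮
  cover : ∀ v, ∃ S ∈ 𝒮, v ∈ S
  tight : ∀ S ∈ 𝒮, ∀ s, s ∉ S → ∀ x ∈ S, ∀ x' ∈ S,
    (∀ y ∈ Cmp G S s, G.Adj x y → y = s) → (∀ y ∈ Cmp G S s, G.Adj x' y → y = s) → x' = x

/-- `S` separates `u` from `v`. -/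
def Splits {V : Type u} (G : SimpleGraph V) (S : Set V) (u v : V) : Prop :=
  u ∉ S ∧ v ∉ S ∧ ¬ ReachOff G S u v

/-- Some member of `𝒮` separates `u` from `v`. -/
def SplitBy {V : Type u} (G : SimpleGraph V) (𝒮 : Set (Set V)) (u v : V) : Prop :=
  ∃ S ∈ 𝒮, Splits G S u v

section Splits

variable {V : Type u} {G : SimpleGraph V} {𝒮 : Set (Set V)} {S S' : Set V} {u v w s x y : V}

theorem Splits.symm (h : Splits G S u v) : Splits G S v u := ⟨h.2.1, h.1, fun h' => h.2.2 h'.symm⟩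

theorem SplitBy.symm : SplitBy G 𝒮 u v → SplitBy G 𝒮 v u := fun ⟨S, hS, h⟩ => ⟨S, hS, h.symm⟩

theorem SplitBy.ne (h : SplitBy G 𝒮 u v) : u ≠ v := by
  rintro rfl
  obtain ⟨S, -, h⟩ := h
  exact h.2.2 (.refl h.1)

theorem Splits.mem_of_adj (h : Splits G S u v) (hu : G.Adj w u) (hv : G.Adj w v) : w ∈ S := by
  by_contra hw
  exact h.2.2 ((ReachOff.of_adj hu.symm h.1 hw).trans (.of_adj hv hw h.2.1))

theorem Splits.map (φ : G ≃g G) (h : Splits G S u v) : Splits G (φ '' S) (φ u) (φ v) := by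
  refine ⟨?_, ?_, fun h' => h.2.2 ?_⟩
  · rintro ⟨x, hx, hxw⟩
    exact h.1 (φ.injective hxw ▸ hx)
  · rintro ⟨x, hx, hxw⟩
    exact h.2.1 (φ.injective hxw ▸ hx)
  · have := ReachOff.map φ.symm h'
    rw [← image_comp] at this
    simpa [Function.comp_def] using this

namespace SepSystem

variable (H : SepSystem G 𝒮)
include H

theorem splitBy_map (φ : G ≃g G) (h : SplitBy G 𝒮 u v) : SplitBy G 𝒮 (φ u) (φ v) :=
  let ⟨S, hS, h⟩ := h
  ⟨_, H.image_mem φ S hS, h.map φ⟩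

/-- A separator meeting a component of `G - S` lies in that component together with `S`. -/
theorem mem_cmp_of_meets (hS : S ∈ 𝒮) (hS' : S' ∈ 𝒮) (hw : w ∈ S') (hwC : w ∈ Cmp G S u)
    (hv : v ∈ S') (hvS : v ∉ S) : v ∈ Cmp G S u :=
  ReachOff.trans hwC (H.nested S hS S' hS' w hw v hv (notMem_of_mem_cmp hwC) hvS)

/-- A component of `G - S'` avoiding `S` lies in any component of `G - S` that `S'` meets. -/
theorem cmp_subset_of_meets (hS' : S' ∈ 𝒮) (hw : w ∈ S') (hwC : w ∈ Cmp G S u) (hv : v ∉ S')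
    (hd : ∀ t ∈ S, t ∉ Cmp G S' v) : Cmp G S' v ⊆ Cmp G S u := by
  obtain ⟨p, hp, hwp⟩ := H.full S' hS' v hv w hw
  have hpC : p ∈ Cmp G S u := mem_cmp_of_adj hwC hwp fun h => hd p h hp
  intro q hq
  have h1 : p ∈ Cmp G S v := cmp_subset_cmp hd hp
  have h2 : q ∈ Cmp G S v := cmp_subset_cmp hd hq
  exact ReachOff.trans hpC (h1.symm.trans h2)

theorem subset_of_cmp_eq (hS : S ∈ 𝒮) (hu : u ∉ S) (h : Cmp G S u = Cmp G S' v) : S ⊆ S' := by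
  intro t ht
  by_contra htS'
  obtain ⟨p, hp, htp⟩ := H.full S hS u hu t ht
  have hp' : p ∈ Cmp G S' v := h ▸ hp
  exact notMem_of_mem_cmp (h ▸ mem_cmp_of_adj hp' htp.symm htS' : t ∈ Cmp G S u) ht

/-- A vertex of a separator has neighbours in two different components. -/
theorem exists_split_neighbours (hS : S ∈ 𝒮) (hs : s ∈ S) :
    ∃ a b, G.Adj s a ∧ G.Adj s b ∧ Splits G S a b := by
  obtain ⟨w, hw, -⟩ := H.exists_far S hS s
  obtain ⟨w', hw', hww'⟩ := H.exists_far S hS w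
  obtain ⟨a, ha, hsa⟩ := H.full S hS w hw s hs
  obtain ⟨b, hb, hsb⟩ := H.full S hS w' hw' s hs
  exact ⟨a, b, hsa, hsb, notMem_of_mem_cmp ha, notMem_of_mem_cmp hb,
    fun h => hww' (ReachOff.trans ha (h.trans (ReachOff.symm hb)))⟩

/-- Only finitely many members of `𝒮` separate two given vertices. -/
theorem finite_splits (u v : V) : {S | S ∈ 𝒮 ∧ Splits G S u v}.Finite := by
  suffices key : ∀ (n : ℕ) (T : Set V), T.Finite →
      (∀ S ∈ 𝒮, T ⊆ S → S.ncard ≤ T.ncard + n) →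
      {S | (S ∈ 𝒮 ∧ Splits G S u v) ∧ T ⊆ S}.Finite by
    by_cases hne : 𝒮.Nonempty
    · obtain ⟨S₀, hS₀⟩ := hne
      refine (key S₀.ncard ∅ finite_empty fun S hS _ => ?_).subset fun S hS => ⟨hS, empty_subset S⟩
      simp [H.ncard_eq S hS S₀ hS₀]
    · exact finite_empty.subset fun S hS => (hne ⟨S, hS.1⟩).elim
  intro n
  induction n with
  | zero =>
    intro T _ hT
    refine (finite_singleton T).subset fun S hS => ?_
    exact (eq_of_subset_of_ncard_le hS.2 (by simpa using hT S hS.1.1 hS.2)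
      (H.finite S hS.1.1)).symm
  | succ n ih =>
    intro T hTf hT
    by_cases hne : ∃ S₀, (S₀ ∈ 𝒮 ∧ Splits G S₀ u v) ∧ T ⊆ S₀ ∧ S₀ ≠ T
    · obtain ⟨S₀, ⟨hS₀, hsp⟩, hTS, hST⟩ := hne
      obtain ⟨t, htS, htT⟩ := exists_of_ssubset (hTS.ssubset_of_ne (Ne.symm hST))
      obtain ⟨a, ha, hta⟩ := H.full S₀ hS₀ u hsp.1 t htS
      obtain ⟨b, hb, htb⟩ := H.full S₀ hS₀ v hsp.2.1 t htS
      have mono : ∀ {p q}, ReachOff G S₀ p q → ReachOff G T p q := fun h =>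
        h.of_cmp_inter fun w hw hwT => notMem_of_mem_cmp hw (hTS hwT)
      have huv : ReachOff G T u v :=
        ((mono ha).trans (.of_adj hta.symm (mono ha).notMem_right htT)).trans
          ((ReachOff.of_adj htb htT (mono hb).notMem_right).trans (mono hb).symm)
      obtain ⟨F, hF, hFT, hFr⟩ := huv.exists_finite
      refine (hF.biUnion (t := fun q => {S | (S ∈ 𝒮 ∧ Splits G S u v) ∧ insert q T ⊆ S})
        fun q hq => ih (insert q T) (hTf.insert q) fun S hS hTS => ?_).subset ?_
      · have := hT S hS ((subset_insert q T).trans hTS)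
        rw [ncard_insert_of_notMem (hFT q hq) hTf]
        omega
      · rintro S ⟨⟨hS, hsS⟩, hTS⟩
        have : ∃ q ∈ F, q ∈ S := by
          by_contra! hcon
          exact hsS.2.2 (hFr S hcon)
        obtain ⟨q, hq, hqS⟩ := this
        exact mem_biUnion hq ⟨⟨hS, hsS⟩, insert_subset hqS hTS⟩
    · push Not at hne
      exact (finite_singleton T).subset fun S hS => hne S hS.1 hS.2

/-- Among the members of `𝒮` separating `u` from `v` there is one closest to `v`. -/
theorem exists_closest (h : SplitBy G 𝒮 u v) :
    ∃ S ∈ 𝒮, Splits G S u v ∧ ∀ S' ∈ 𝒮, Splits G S' u v → Cmp G S v ⊆ Cmp G S' v := by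
  obtain ⟨S₀, hS₀, hsp₀⟩ := h
  obtain ⟨S, ⟨hS, hsp⟩, hmin⟩ := (H.finite_splits u v).exists_minimalFor (fun S => Cmp G S v) _
    ⟨S₀, hS₀, hsp₀⟩
  refine ⟨S, hS, hsp, fun S' hS' hsp' => ?_⟩
  by_cases hm : ∃ w ∈ S', w ∈ Cmp G S v
  · obtain ⟨w, hw, hwC⟩ := hm
    by_cases hm' : ∃ w' ∈ S, w' ∈ Cmp G S' v
    · exfalso
      obtain ⟨w', hw', hwC'⟩ := hm'
      have h1 : Cmp G S u ⊆ Cmp G S' u := cmp_subset_cmp fun t ht htC => hsp.2.2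
        (ReachOff.trans htC (H.mem_cmp_of_meets hS hS' hw hwC ht (notMem_of_mem_cmp htC)).symm)
      have h2 : Cmp G S' u ⊆ Cmp G S u := cmp_subset_cmp fun t ht htC => hsp'.2.2
        (ReachOff.trans htC (H.mem_cmp_of_meets hS' hS hw' hwC' ht (notMem_of_mem_cmp htC)).symm)
      have h3 := H.subset_of_cmp_eq hS' hsp'.1 (h2.antisymm h1)
      exact notMem_of_mem_cmp hwC (h3 hw)
    · push Not at hm'
      exact hmin ⟨hS', hsp'⟩ (H.cmp_subset_of_meets hS' hw hwC hsp'.2.1 hm')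
  · push Not at hm
    exact cmp_subset_cmp hm

end SepSystem

end Splits


/-- The separators of a basic cut system of a triangle-free digraph, together with the part of
C-homogeneity that concerns stars. -/
structure HomSystem {V : Type u} (E : V → V → Prop) (G : SimpleGraph V) (𝒮 : Set (Set V)) : Prop
    extends SepSystem G 𝒮 where
  adj_iff : ∀ x y, G.Adj x y ↔ E x y ∨ E y x
  asymm : ∀ x y, E x y → ¬ E y x
  connected : G.Connected
  star : ∀ (n : ℕ) (c c' : V) (f g : Fin n → V), Function.Injective f → Function.Injective g →
    (∀ i, G.Adj c (f i)) → (∀ i, G.Adj c' (g i)) → (∀ i, E c (f i) ↔ E c' (g i)) →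
    ∃ ψ : G ≃g G, (∀ x y, E (ψ x) (ψ y) ↔ E x y) ∧ ψ c = c' ∧ ∀ i, ψ (f i) = g i

/-- Any two out-neighbours of a vertex are separated by a member of `𝒮`. -/
def OutSep {V : Type u} (E : V → V → Prop) (G : SimpleGraph V) (𝒮 : Set (Set V)) : Prop :=
  ∀ s y z, E s y → E s z → y ≠ z → SplitBy G 𝒮 y z

/-- No two out-neighbours of a vertex are separated by a member of `𝒮`. -/
def OutTog {V : Type u} (E : V → V → Prop) (G : SimpleGraph V) (𝒮 : Set (Set V)) : Prop :=
  ∀ s y z, E s y → E s z → ¬ SplitBy G 𝒮 y z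

/-- Every in-neighbour of a vertex is separated from every out-neighbour by a member of `𝒮`. -/
def MixSep {V : Type u} (E : V → V → Prop) (G : SimpleGraph V) (𝒮 : Set (Set V)) : Prop :=
  ∀ x s y, E x s → E s y → SplitBy G 𝒮 x y

/-- No in-neighbour of a vertex is separated from an out-neighbour by a member of `𝒮`. -/
def MixTog {V : Type u} (E : V → V → Prop) (G : SimpleGraph V) (𝒮 : Set (Set V)) : Prop :=
  ∀ x s y, E x s → E s y → ¬ SplitBy G 𝒮 x y

/-- `S` contains `x`, and `s` is the only neighbour of `x` in its component of `G - S`. -/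
def IsGate {V : Type u} (G : SimpleGraph V) (S : Set V) (x s : V) : Prop :=
  x ∈ S ∧ s ∉ S ∧ ∀ y, G.Adj x y → y ∈ Cmp G S s → y = s

namespace HomSystem

variable {V : Type u} {E : V → V → Prop} {G : SimpleGraph V} {𝒮 : Set (Set V)}

theorem rev (H : HomSystem E G 𝒮) : HomSystem (flip E) G 𝒮 where
  toSepSystem := H.toSepSystem
  adj_iff x y := (H.adj_iff x y).trans or_comm
  asymm x y h := H.asymm y x h
  connected := H.connected
  star n c c' f g hf hg hcf hcg hfg := by
    have key : ∀ i, E c (f i) ↔ E c' (g i) := by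
      intro i
      have h1 := (H.adj_iff _ _).1 (hcf i)
      have h2 := (H.adj_iff _ _).1 (hcg i)
      have h3 := H.asymm c (f i)
      have h4 := H.asymm c' (g i)
      have h5 : E (f i) c ↔ E (g i) c' := hfg i
      tauto
    obtain ⟨ψ, hψ, h⟩ := H.star n c c' f g hf hg hcf hcg key
    exact ⟨ψ, fun x y => hψ y x, h⟩

variable (H : HomSystem E G 𝒮)
include H

theorem adj_of {x y : V} (h : E x y) : G.Adj x y := (H.adj_iff x y).2 (.inl h)

theorem adj_of' {x y : V} (h : E x y) : G.Adj y x := (H.adj_of h).symm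

theorem ne_of_in_out {x s y : V} (hx : E x s) (hy : E s y) : x ≠ y := by
  rintro rfl
  exact H.asymm _ _ hx hy

theorem exists_map (a b : V) : ∃ ψ : G ≃g G, (∀ x y, E (ψ x) (ψ y) ↔ E x y) ∧ ψ a = b := by
  obtain ⟨ψ, hψ, h, -⟩ := H.star 0 a b ![] ![] (Function.injective_of_subsingleton _)
    (Function.injective_of_subsingleton _) (fun i => i.elim0) (fun i => i.elim0) (fun i => i.elim0)
  exact ⟨ψ, hψ, h⟩

theorem exists_map_pair {c c' a b a' b' : V} (hab : a ≠ b) (hab' : a' ≠ b')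
    (ha : G.Adj c a) (hb : G.Adj c b) (ha' : G.Adj c' a') (hb' : G.Adj c' b')
    (h1 : E c a ↔ E c' a') (h2 : E c b ↔ E c' b') :
    ∃ ψ : G ≃g G, (∀ x y, E (ψ x) (ψ y) ↔ E x y) ∧ ψ c = c' ∧ ψ a = a' ∧ ψ b = b' := by
  have inj : ∀ {p q : V}, p ≠ q → Function.Injective ![p, q] := by
    intro p q h i j
    fin_cases i <;> fin_cases j <;> simp [h, h.symm]
  obtain ⟨ψ, hψ, h, h'⟩ := H.star 2 c c' ![a, b] ![a', b'] (inj hab) (inj hab')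
    (by simp [Fin.forall_fin_two, ha, hb]) (by simp [Fin.forall_fin_two, ha', hb'])
    (by simp [Fin.forall_fin_two, h1, h2])
  exact ⟨ψ, hψ, h, h' 0, h' 1⟩

theorem outSep_or_outTog : OutSep E G 𝒮 ∨ OutTog E G 𝒮 := by
  by_contra! h
  simp only [OutSep, OutTog, not_forall, not_not] at h
  obtain ⟨⟨s, y, z, hy, hz, hne, hn⟩, s', y', z', hy', hz', hsp⟩ := h
  obtain ⟨ψ, -, -, h1, h2⟩ := H.exists_map_pair hsp.ne hne (H.adj_of hy') (H.adj_of hz')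
    (H.adj_of hy) (H.adj_of hz) (by simp [*]) (by simp [*])
  exact hn (h1 ▸ h2 ▸ H.splitBy_map ψ hsp)

theorem mixSep_or_mixTog : MixSep E G 𝒮 ∨ MixTog E G 𝒮 := by
  by_contra! h
  simp only [MixSep, MixTog, not_forall, not_not] at h
  obtain ⟨⟨x, s, y, hx, hy, hn⟩, x', s', y', hx', hy', hsp⟩ := h
  obtain ⟨ψ, -, -, h1, h2⟩ := H.exists_map_pair hsp.ne (H.ne_of_in_out hx hy) (H.adj_of' hx')
    (H.adj_of hy') (H.adj_of' hx) (H.adj_of hy)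
    (iff_of_false (H.asymm _ _ hx') (H.asymm _ _ hx)) (iff_of_true hy' hy)
  exact hn (h1 ▸ h2 ▸ H.splitBy_map ψ hsp)

theorem exists_edge : ∃ a b, E a b := by
  obtain ⟨v⟩ := H.connected.nonempty
  obtain ⟨S, hS, hv⟩ := H.cover v
  obtain ⟨a, -, ha, -⟩ := H.exists_split_neighbours hS hv
  rcases (H.adj_iff _ _).1 ha with h | h
  exacts [⟨_, _, h⟩, ⟨_, _, h⟩]

theorem not_mixTog_of_inTog (hm : MixTog E G 𝒮) (hi : OutTog (flip E) G 𝒮) : False := by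
  obtain ⟨v⟩ := H.connected.nonempty
  have hin : ∀ S ∈ 𝒮, ∀ v ∈ S, ∀ x, E x v → x ∈ S := by
    intro S hS v hv x hx
    obtain ⟨a, b, ha, hb, hsp⟩ := H.exists_split_neighbours hS hv
    have hab : SplitBy G 𝒮 a b := ⟨S, hS, hsp⟩
    have hout : E v a ∧ E v b := by
      rcases (H.adj_iff _ _).1 ha with h | h <;> rcases (H.adj_iff _ _).1 hb with h' | h'
      · exact ⟨h, h'⟩
      · exact (hm b v a h' h hab.symm).elim
      · exact (hm a v b h h' hab).elim
      · exact (hi v a b h h' hab).elim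
    by_contra hxS
    have h1 : ReachOff G S x a := by
      by_contra h
      exact hm x v a hx hout.1 ⟨S, hS, hxS, hsp.1, h⟩
    have h2 : ReachOff G S x b := by
      by_contra h
      exact hm x v b hx hout.2 ⟨S, hS, hxS, hsp.2.1, h⟩
    exact hsp.2.2 (h1.symm.trans h2)
  have hA : ∀ S ∈ 𝒮, ∀ v ∈ S, {w | Relation.ReflTransGen E w v} ⊆ S := by
    intro S hS v hv w hw
    induction hw using Relation.ReflTransGen.head_induction_on with
    | refl => exact hv
    | head h _ ih => exact hin S hS _ ih _ h
  have hfin : ∀ v, {w | Relation.ReflTransGen E w v}.Finite := fun v =>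
    let ⟨S, hS, hv⟩ := H.cover v
    (H.finite S hS).subset (hA S hS v hv)
  have hcard : ∀ a b, {w | Relation.ReflTransGen E w a}.ncard ≤
      {w | Relation.ReflTransGen E w b}.ncard := by
    intro a b
    obtain ⟨ψ, hψ, rfl⟩ := H.exists_map a b
    refine ncard_le_ncard_of_injOn ψ (fun w hw => ?_) ψ.injective.injOn (hfin _)
    exact Relation.ReflTransGen.lift ψ (fun p q h => (hψ p q).2 h) w a hw
  have hE : ∀ a b, E a b →
      {w | Relation.ReflTransGen E w a} = {w | Relation.ReflTransGen E w b} := fun a b h =>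
    eq_of_subset_of_ncard_le (fun w hw => Relation.ReflTransGen.tail hw h) (hcard b a) (hfin b)
  have hall : ∀ w, {x | Relation.ReflTransGen E x w} = {x | Relation.ReflTransGen E x v} := by
    intro w
    obtain ⟨p⟩ := H.connected.preconnected w v
    induction p with
    | nil => rfl
    | cons h _ ih =>
      rw [← ih]
      rcases (H.adj_iff _ _).1 h with h | h
      exacts [hE _ _ h, (hE _ _ h).symm]
  obtain ⟨S, hS, hv⟩ := H.cover v
  obtain ⟨w, hw, -⟩ := H.exists_far S hS v
  have hww : w ∈ {x | Relation.ReflTransGen E x w} := Relation.ReflTransGen.refl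
  exact hw (hA S hS v hv (hall w ▸ hww))

theorem mixSep : MixSep E G 𝒮 := by
  refine H.mixSep_or_mixTog.resolve_right fun hm => ?_
  by_cases hi : OutTog (flip E) G 𝒮
  · exact H.not_mixTog_of_inTog hm hi
  by_cases ho : OutTog E G 𝒮
  · exact H.rev.not_mixTog_of_inTog (fun x s y hx hy h => hm y s x hy hx h.symm) ho
  simp only [OutTog, not_forall, not_not] at hi ho
  obtain ⟨s, y, z, hy, hz, S, hS, hsp⟩ := ho
  obtain ⟨s', x, x', hx, hx', hsp'⟩ := hi
  obtain ⟨ψ, hψ, rfl⟩ := H.exists_map s' s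
  obtain ⟨S', hS', hsp'⟩ := H.splitBy_map ψ hsp'
  have hin : ∀ x, E x s' → ψ x ∈ S := by
    intro x hx
    have hx := (hψ _ _).2 hx
    by_contra hxS
    have h1 : ReachOff G S (ψ x) y := by
      by_contra h
      exact hm _ _ _ hx hy ⟨S, hS, hxS, hsp.1, h⟩
    have h2 : ReachOff G S (ψ x) z := by
      by_contra h
      exact hm _ _ _ hx hz ⟨S, hS, hxS, hsp.2.1, h⟩
    exact hsp.2.2 (h1.symm.trans h2)
  exact hsp'.2.2 (H.nested S' hS' S hS _ (hin x hx) _ (hin x' hx') hsp'.1 hsp'.2.1)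

theorem exists_out (v : V) : ∃ y, E v y := by
  obtain ⟨a, b, hab⟩ := H.exists_edge
  obtain ⟨ψ, hψ, rfl⟩ := H.exists_map a v
  exact ⟨_, (hψ _ _).2 hab⟩

/-- A separator closest to `s` among those separating it from `u` cuts off a component that
contains no component cut off around another out-neighbour. -/
theorem not_ssubset_of_closest {u x s y : V} {S S' : Set V} (hux : E u x) (hxs : E x s)
    (hxy : E x y) (hcl : ∀ S' ∈ 𝒮, Splits G S' u s → Cmp G S s ⊆ Cmp G S' s)
    (hS' : S' ∈ 𝒮) (hsp' : Splits G S' u y) : ¬ Cmp G S' y ⊂ Cmp G S s := by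
  intro hss
  by_cases hys : y = s
  · subst hys
    exact hss.2 (hcl S' hS' hsp')
  have inj : ∀ {p q : V}, E x p → E x q → p ≠ q → Function.Injective ![u, p, q] := by
    intro p q hp hq h i j
    have h1 := H.ne_of_in_out hux hp
    have h2 := H.ne_of_in_out hux hq
    fin_cases i <;> fin_cases j <;> simp [h, h.symm, h1, h1.symm, h2, h2.symm]
  obtain ⟨φ, -, -, h⟩ := H.star 3 x x ![u, s, y] ![u, y, s] (inj hxs hxy (Ne.symm hys))
    (inj hxy hxs hys) (by simp [Fin.forall_fin_succ, H.adj_of hxs, H.adj_of hxy, H.adj_of' hux])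
    (by simp [Fin.forall_fin_succ, H.adj_of hxs, H.adj_of hxy, H.adj_of' hux])
    (by simp [Fin.forall_fin_succ, hxs, hxy])
  have hu : φ u = u := h 0
  have hs : φ s = y := h 1
  have hy : φ y = s := h 2
  have hu' : φ.symm u = u := by rw [RelIso.symm_apply_eq, hu]
  have hy' : φ.symm y = s := by rw [RelIso.symm_apply_eq, hs]
  have h1 : Cmp G S s ⊆ φ '' Cmp G S' y := by
    rw [image_cmp, hy]
    exact hcl _ (H.image_mem φ S' hS') (hu ▸ hy ▸ hsp'.map φ)
  have h2 : Cmp G S s ⊆ φ.symm '' Cmp G S' y := by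
    rw [image_cmp, hy']
    have := hsp'.map φ.symm
    rw [hu', hy'] at this
    exact hcl _ (H.image_mem φ.symm S' hS') this
  have h3 : φ '' Cmp G S s ⊆ Cmp G S' y := by
    rintro _ ⟨w, hw, rfl⟩
    obtain ⟨w', hw', rfl⟩ := h2 hw
    simpa using hw'
  have h4 : φ '' Cmp G S' y ⊆ φ '' Cmp G S s := image_mono hss.1
  exact hss.2 (h1.trans (h4.trans h3))

end HomSystem

/-- A graph that is connected but not a tree has a periodic non-backtracking walk. -/
theorem exists_periodic_walk {V : Type u} {G : SimpleGraph V} (hc : G.Connected)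
    (ht : ¬ G.IsTree) : ∃ (v : ℕ → V) (n : ℕ), 3 ≤ n ∧ (∀ i, G.Adj (v i) (v (i + 1))) ∧
      (∀ i, v i ≠ v (i + 2)) ∧ ∀ i, v (i + n) = v i := by
  have hac : ¬ G.IsAcyclic := fun h => ht ⟨hc, h⟩
  simp only [SimpleGraph.IsAcyclic, not_forall, not_not] at hac
  obtain ⟨a, p, hp⟩ := hac
  have h3 := hp.three_le_length
  refine ⟨fun i => p.getVert (i % p.length), p.length, h3, fun i => ?_, fun i h => ?_, fun i => ?_⟩
  · have hlt : i % p.length < p.length := Nat.mod_lt _ (by omega)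
    have := p.adj_getVert_succ hlt
    by_cases hi : i % p.length + 1 = p.length
    · have h0 : (i + 1) % p.length = 0 := by
        rw [Nat.add_mod, Nat.mod_eq_of_lt (show 1 < p.length by omega), hi, Nat.mod_self]
      rw [hi, p.getVert_length] at this
      simpa [h0] using this
    · have h0 : (i + 1) % p.length = i % p.length + 1 := by
        rw [Nat.add_mod, Nat.mod_eq_of_lt (show 1 < p.length by omega),
          Nat.mod_eq_of_lt (by omega)]
      simpa only [h0] using this
  · have hm : ∀ j, j % p.length ∈ {i | i ≤ p.length - 1} := fun j => by
      have := Nat.mod_lt j (show 0 < p.length by omega)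
      simp only [mem_ofPred_eq]
      omega
    have h' := hp.getVert_injOn' (hm i) (hm (i + 2)) h
    have h'' : (i + 0) ≡ (i + 2) [MOD p.length] := h'
    have := Nat.ModEq.add_left_cancel' i h''
    rw [Nat.ModEq, Nat.zero_mod, Nat.mod_eq_of_lt (by omega)] at this
    omega
  · simp

namespace HomSystem

variable {V : Type u} {E : V → V → Prop} {G : SimpleGraph V} {𝒮 : Set (Set V)}
  {S S' : Set V} {u x x' s y : V}

section

variable (H : HomSystem E G 𝒮)
include H

/-- Not all pairs of neighbours of a vertex are separated. -/
theorem not_outSep_inSep (ho : OutSep E G 𝒮) (hi : OutSep (flip E) G 𝒮)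
    (ht : ¬ G.IsTree) : False := by
  have hall : ∀ a b c, G.Adj b a → G.Adj b c → a ≠ c → SplitBy G 𝒮 a c := by
    intro a b c ha hc hne
    rcases (H.adj_iff _ _).1 ha with h | h <;> rcases (H.adj_iff _ _).1 hc with h' | h'
    exacts [ho _ _ _ h h' hne, (H.mixSep _ _ _ h' h).symm, H.mixSep _ _ _ h h', hi _ _ _ h h' hne]
  obtain ⟨v, n, hn, hadj, hne, hper⟩ := exists_periodic_walk H.connected ht
  have key : ∀ d, 2 ≤ d → ∀ i, ∀ S ∈ 𝒮, v i ∈ S → v (i + d) ∉ S := by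
    intro d
    induction d using Nat.strong_induction_on with
    | _ d ih =>
      intro hd i S hS hi hid
      obtain ⟨S₁, hS₁, hsp⟩ :=
        hall (v i) (v (i + 1)) (v (i + 2)) (hadj i).symm (hadj (i + 1)) (hne i)
      have h1 : v (i + 1) ∈ S₁ := hsp.mem_of_adj (hadj i).symm (hadj (i + 1))
      by_cases hj : ∃ j, 2 < j ∧ j ≤ d ∧ v (i + j) ∈ S₁
      · obtain ⟨j, hj2, hjd, hj⟩ := hj
        exact ih (j - 1) (by omega) (by omega) (i + 1) S₁ hS₁ h1
          (by rwa [show i + 1 + (j - 1) = i + j by omega])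
      · push Not at hj
        have hr : ∀ j, j + 2 ≤ d → ReachOff G S₁ (v (i + 2)) (v (i + (j + 2))) := by
          intro j
          induction j with
          | zero => exact fun _ => .refl hsp.2.1
          | succ j ihj =>
            intro hjd
            have := ihj (by omega)
            exact this.trans (.of_adj (hadj _) this.notMem_right (hj (j + 1 + 2) (by omega) hjd))
        have hd' := hr (d - 2) (by omega)
        rw [show d - 2 + 2 = d by omega] at hd'
        exact hsp.2.2 ((H.nested S₁ hS₁ S hS _ hi _ hid hsp.1 hd'.notMem_right).trans hd'.symm)
  obtain ⟨S, hS, h0⟩ := H.cover (v 0)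
  exact key n (by omega) 0 S hS h0 (by rwa [hper 0])

theorem exists_isGate (ho : OutSep E G 𝒮) (hi : OutTog (flip E) G 𝒮) (hux : E u x)
    (hxs : E x s) : ∃ S ∈ 𝒮, IsGate G S x s ∧ u ∉ S := by
  obtain ⟨S, hS, hsp, hcl⟩ := H.exists_closest (H.mixSep u x s hux hxs)
  have hxS : x ∈ S := hsp.mem_of_adj (H.adj_of' hux) (H.adj_of hxs)
  have huK : u ∉ Cmp G S s := fun h => hsp.2.2 (ReachOff.symm h)
  refine ⟨S, hS, ⟨hxS, hsp.2.1, fun y hxy hy => ?_⟩, hsp.1⟩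
  by_contra hys
  have hyS : y ∉ S := notMem_of_mem_cmp hy
  rcases (H.adj_iff _ _).1 hxy with hxy | hyx
  · obtain ⟨S', hS', hsp'⟩ := ho x s y hxs hxy (Ne.symm hys)
    obtain ⟨w, hw, hwK⟩ : ∃ w ∈ S', w ∈ Cmp G S s := by
      by_contra! h
      exact hsp'.2.2 (cmp_subset_cmp h hy)
    have huS' : u ∉ S' := fun h => huK (H.mem_cmp_of_meets hS hS' hw hwK h hsp.1)
    by_cases hd : ∃ t ∈ S, t ∈ Cmp G S' s
    · obtain ⟨t, ht, htC⟩ := hd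
      have hav : ∀ t' ∈ S, t' ∉ Cmp G S' y := fun t' ht' h => hsp'.2.2
        (ReachOff.trans (H.mem_cmp_of_meets hS' hS ht htC ht' (notMem_of_mem_cmp h)) h.symm)
      have hsub := H.cmp_subset_of_meets hS' hw hwK hsp'.2.1 hav
      refine H.not_ssubset_of_closest hux hxs hxy hcl hS'
        ⟨huS', hsp'.2.1, fun h => huK (hsub h.symm)⟩ ⟨hsub, fun h => ?_⟩
      exact hsp'.2.2 (ReachOff.symm (h (mem_cmp_self hsp.2.1)))
    · push Not at hd
      have hsub := H.cmp_subset_of_meets hS' hw hwK hsp'.1 hd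
      exact hsp'.2.2 (hcl S' hS' ⟨huS', hsp'.1, fun h => huK (hsub h.symm)⟩ hy)
  · exact hi x u y hux hyx ⟨S, hS, hsp.1, hyS, fun h => huK (ReachOff.trans hy h.symm)⟩

theorem notMem_of_isGate (hxs : E x s) (hx's : E x' s) (hne : x ≠ x') (hS : S ∈ 𝒮)
    (hg : IsGate G S x s) : x' ∉ S := by
  intro hx'
  obtain ⟨φ, -, hs, hxx', hx'x⟩ := H.exists_map_pair hne hne.symm (H.adj_of' hxs)
    (H.adj_of' hx's) (H.adj_of' hx's) (H.adj_of' hxs)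
    (iff_of_false (H.asymm _ _ hxs) (H.asymm _ _ hx's))
    (iff_of_false (H.asymm _ _ hx's) (H.asymm _ _ hxs))
  obtain ⟨hxS, hsS, hg⟩ := hg
  obtain ⟨z, hzK, hz, hzs⟩ : ∃ z ∈ Cmp G S s, G.Adj x' z ∧ z ≠ s := by
    by_contra! h
    exact hne (H.tight S hS s hsS x hxS x' hx' (fun y hy ha => hg y ha hy) h).symm
  have hK' : φ '' Cmp G S s = Cmp G (φ '' S) s := by rw [image_cmp, hs]
  have hS' := H.image_mem φ S hS
  have hxS' : x ∈ φ '' S := ⟨x', hx', hx'x⟩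
  have hg' : ∀ y, G.Adj x' y → y ∈ Cmp G (φ '' S) s → y = s := by
    rw [← hK', ← hxx']
    rintro _ ha ⟨y, hy, rfl⟩
    rw [hg y (φ.map_adj_iff.1 ha) hy, hs]
  obtain ⟨p, hp, hpK⟩ : ∃ p ∈ φ '' S, p ∈ Cmp G S s := by
    by_contra! h
    exact hzs (hg' z hz (cmp_subset_cmp h hzK))
  obtain ⟨q, hq, hqK⟩ : ∃ q ∈ S, q ∈ Cmp G (φ '' S) s := by
    by_contra! h
    have h1 : φ z ∈ Cmp G (φ '' S) s := hK' ▸ mem_image_of_mem φ hzK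
    have h2 : G.Adj x (φ z) := hx'x ▸ φ.map_adj_iff.2 hz
    exact hzs (φ.injective ((hg _ h2 (cmp_subset_cmp h h1)).trans hs.symm))
  obtain ⟨w, hw, hwK⟩ := H.exists_far _ hS' s
  have hsub := H.cmp_subset_of_meets hS' hp hpK hw fun t ht htC => hwK
    (ReachOff.trans (H.mem_cmp_of_meets hS' hS hq hqK ht (notMem_of_mem_cmp htC)) htC.symm)
  obtain ⟨v, hv, hxv⟩ := H.full _ hS' w hw x hxS'
  exact hwK (hg v hxv (hsub hv) ▸ hv.symm)

theorem gate_forward (hxs : E x s) (hsy : E s y) (hS : S ∈ 𝒮) (hS' : S' ∈ 𝒮)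
    (hg : IsGate G S x s) (hg' : IsGate G S' s y) : Cmp G S' y ⊂ Cmp G S s := by
  obtain ⟨hxS, hsS, hg⟩ := hg
  obtain ⟨hsS', hyS', hg'⟩ := hg'
  have hsK := mem_cmp_self (G := G) hsS
  have hxK' : x ∉ Cmp G S' y := fun h =>
    H.ne_of_in_out hxs hsy (hg' x (H.adj_of' hxs) h)
  refine ⟨H.cmp_subset_of_meets hS' hsS' hsK hyS' ?_, fun h => notMem_of_mem_cmp (h hsK) hsS'⟩
  by_contra! hm
  obtain ⟨t, ht, htK'⟩ := hm
  have hxS' : x ∈ S' := by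
    by_contra hx
    exact hxK' (H.mem_cmp_of_meets hS' hS ht htK' hxS hx)
  obtain ⟨w, hw, hwK'⟩ := H.exists_far S' hS' y
  have hsub := H.cmp_subset_of_meets hS' hsS' hsK hw fun t' ht' htC => hwK'
    (ReachOff.trans (H.mem_cmp_of_meets hS' hS ht htK' ht' (notMem_of_mem_cmp htC)) htC.symm)
  obtain ⟨v, hv, hxv⟩ := H.full S' hS' w hw x hxS'
  exact notMem_of_mem_cmp (hg v hxv (hsub hv) ▸ hv) hsS'

theorem gate_turn_back (hxs : E x s) (hx's : E x' s) (hne : x ≠ x') (hS : S ∈ 𝒮) (hS' : S' ∈ 𝒮)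
    (hg : IsGate G S x s) (hg' : IsGate G S' x' s) :
    {w | w ∉ S' ∧ w ∉ Cmp G S' s} ⊂ Cmp G S s := by
  have hsK := mem_cmp_self (G := G) hg.2.1
  have hsK' := mem_cmp_self (G := G) hg'.2.1
  have hx'K := mem_cmp_of_adj hsK (H.adj_of' hx's) (H.notMem_of_isGate hxs hx's hne hS hg)
  have hxK' := mem_cmp_of_adj hsK' (H.adj_of' hxs) (H.notMem_of_isGate hx's hxs hne.symm hS' hg')
  refine ⟨fun w ⟨hw, hwK'⟩ => ?_, fun h => (h hsK).2 hsK'⟩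
  refine H.cmp_subset_of_meets hS' hg'.1 hx'K hw (fun t ht htC => hwK' ?_) (mem_cmp_self hw)
  exact ReachOff.trans (H.mem_cmp_of_meets hS' hS hg.1 hxK' ht (notMem_of_mem_cmp htC)) htC.symm

theorem gate_backward (hux : E u x) (hxs : E x s) (hS : S ∈ 𝒮) (hS' : S' ∈ 𝒮)
    (hg : IsGate G S x s) (hg' : IsGate G S' u x) :
    {w | w ∉ S' ∧ w ∉ Cmp G S' x} ⊂ {w | w ∉ S ∧ w ∉ Cmp G S s} := by
  have hsub := (H.gate_forward hux hxs hS' hS hg' hg).1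
  have hxK' := mem_cmp_self (G := G) hg'.2.1
  refine ⟨fun w ⟨hw, hwK'⟩ => ⟨fun hwS => hwK' (H.mem_cmp_of_meets hS' hS hg.1 hxK' hwS hw),
    fun h => hwK' (hsub h)⟩, fun h => ?_⟩
  obtain ⟨w, hw, hwK⟩ := H.exists_far S hS s
  obtain ⟨v, hv, hxv⟩ := H.full S hS w hw x hg.1
  have := h ⟨notMem_of_mem_cmp hv, fun h' => hwK (ReachOff.trans h' hv.symm)⟩
  exact this.2 (mem_cmp_of_adj hxK' hxv this.1)

theorem gate_turn_forward (hux : E u x) (hxs : E x s) (hxy : E x y) (hne : s ≠ y)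
    (hS : S ∈ 𝒮) (hS' : S' ∈ 𝒮) (hg : IsGate G S x y) (hg' : IsGate G S' x s)
    (hu : u ∉ S) (hu' : u ∉ S') : Cmp G S y ⊂ {w | w ∉ S' ∧ w ∉ Cmp G S' s} := by
  obtain ⟨hxS, hyS, hg⟩ := hg
  obtain ⟨hxS', hsS', hg'⟩ := hg'
  have huK : u ∉ Cmp G S y := fun h => H.ne_of_in_out hux hxy (hg u (H.adj_of' hux) h)
  have huK' : u ∉ Cmp G S' s := fun h => H.ne_of_in_out hux hxs (hg' u (H.adj_of' hux) h)
  have hav : ∀ t ∈ S', t ∉ Cmp G S y := by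
    intro p hp hpK
    by_cases hd : ∃ t ∈ S, t ∈ Cmp G S' s
    · obtain ⟨t, ht, htK'⟩ := hd
      have hsub := H.cmp_subset_of_meets hS ht htK' hu fun t' ht' htC => huK
        (ReachOff.trans (H.mem_cmp_of_meets hS hS' hp hpK ht' (notMem_of_mem_cmp htC)) htC.symm)
      exact huK' (hsub (mem_cmp_self hu))
    · push Not at hd
      have hsub := H.cmp_subset_of_meets hS' hp hpK hsS' hd
      exact hne (hg s (H.adj_of hxs) (hsub (mem_cmp_self hsS')))
  have hsub : Cmp G S y ⊆ Cmp G S' y := cmp_subset_cmp hav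
  have hyK' : y ∉ Cmp G S' s := fun h => hne (hg' y (H.adj_of hxy) h).symm
  refine ⟨fun w hw => ⟨notMem_of_mem_cmp (hsub hw), fun h => hyK' ?_⟩, fun h => huK (h ⟨hu', huK'⟩)⟩
  exact ReachOff.trans h (hsub hw).symm

/-- It is impossible that out-neighbours are separated and in-neighbours are not. -/
theorem not_outSep_inTog (ho : OutSep E G 𝒮) (hi : OutTog (flip E) G 𝒮)
    (ht : ¬ G.IsTree) : False := by
  choose p hp using H.rev.exists_out
  have hg : ∀ x s, ∃ S, E x s → S ∈ 𝒮 ∧ IsGate G S x s ∧ p x ∉ S := by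
    intro x s
    by_cases hxs : E x s
    · obtain ⟨S, hS, h⟩ := H.exists_isGate ho hi (hp x) hxs
      exact ⟨S, fun _ => ⟨hS, h⟩⟩
    · exact ⟨∅, fun h => (hxs h).elim⟩
  choose σ hσ using hg
  classical
  let ahead : V → V → Set V := fun a b =>
    if E a b then Cmp G (σ a b) b else {w | w ∉ σ b a ∧ w ∉ Cmp G (σ b a) a}
  have key : ∀ a b c, G.Adj a b → G.Adj b c → a ≠ c → ahead b c ⊂ ahead a b := by
    intro a b c hab hbc hne
    have hpos : ∀ {a b}, E a b → ahead a b = Cmp G (σ a b) b := fun h => if_pos h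
    have hneg : ∀ {a b}, E b a → ahead a b = {w | w ∉ σ b a ∧ w ∉ Cmp G (σ b a) a} :=
      fun h => if_neg (H.asymm _ _ h)
    rcases (H.adj_iff _ _).1 hab with h | h <;> rcases (H.adj_iff _ _).1 hbc with h' | h' <;>
      obtain ⟨h1, h2, h3⟩ := hσ _ _ h <;> obtain ⟨h1', h2', h3'⟩ := hσ _ _ h'
    · rw [hpos h, hpos h']
      exact H.gate_forward h h' h1 h1' h2 h2'
    · rw [hpos h, hneg h']
      exact H.gate_turn_back h h' hne h1 h1' h2 h2'
    · rw [hneg h, hpos h']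
      exact H.gate_turn_forward (hp b) h h' hne h1' h1 h2' h2 h3' h3
    · rw [hneg h, hneg h']
      exact H.gate_backward h' h h1 h1' h2 h2'
  obtain ⟨v, n, hn, hadj, hne, hper⟩ := exists_periodic_walk H.connected ht
  have hanti : StrictAnti fun i => ahead (v i) (v (i + 1)) :=
    strictAnti_nat_of_succ_lt fun i => key _ _ _ (hadj i) (hadj (i + 1)) (hne i)
  have := hanti (show 0 < n by omega)
  have h0 := hper 0
  have h1 := hper 1
  rw [Nat.zero_add] at h0
  rw [Nat.add_comm] at h1
  simp only [h0, h1, Nat.zero_add, lt_self_iff_false] at this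

theorem not_outSep (ht : ¬ G.IsTree) : ¬ OutSep E G 𝒮 := fun ho => by
  rcases H.rev.outSep_or_outTog with hi | hi
  exacts [H.not_outSep_inSep ho hi ht, H.not_outSep_inTog ho hi ht]

theorem outTog (ht : ¬ G.IsTree) : OutTog E G 𝒮 :=
  H.outSep_or_outTog.resolve_left (H.not_outSep ht)

theorem exists_two_out (ht : ¬ G.IsTree) (s : V) : ∃ y z, y ≠ z ∧ E s y ∧ E s z := by
  have h := H.not_outSep ht
  simp only [OutSep, not_forall] at h
  obtain ⟨s', y, z, hy, hz, hne, -⟩ := h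
  obtain ⟨ψ, hψ, rfl⟩ := H.exists_map s' s
  exact ⟨ψ y, ψ z, ψ.injective.ne hne, (hψ _ _).2 hy, (hψ _ _).2 hz⟩

end

end HomSystem

/-- `𝒞` is a family of separations whose separators belong to `𝒮` and which contains all cuts
given by a component of the complement of a member of `𝒮`. -/
structure CutFamily {V : Type u} (G : SimpleGraph V) (𝒮 : Set (Set V))
    (𝒞 : Set (Set V × Set V)) : Prop where
  inter_mem : ∀ c ∈ 𝒞, c.1 ∩ c.2 ∈ 𝒮
  union_eq : ∀ c ∈ 𝒞, c.1 ∪ c.2 = univ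
  nonempty_left : ∀ c ∈ 𝒞, (c.1 \ c.2).Nonempty
  nonempty_right : ∀ c ∈ 𝒞, (c.2 \ c.1).Nonempty
  not_reachOff : ∀ c ∈ 𝒞, ∀ a ∈ c.1 \ c.2, ∀ b ∈ c.2 \ c.1, ¬ ReachOff G (c.1 ∩ c.2) a b
  exists_cut : ∀ S ∈ 𝒮, ∀ u, u ∉ S → ∃ c ∈ 𝒞, c.1 ∩ c.2 = S ∧ c.1 \ c.2 = Cmp G S u

/-- `P` and `Q` are the two sides of a member of `𝒞`. -/
def AreSides {V : Type u} (𝒞 : Set (Set V × Set V)) (P Q : Set V) : Prop :=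
  (P, Q) ∈ 𝒞 ∨ (Q, P) ∈ 𝒞

namespace AreSides

variable {V : Type u} {G : SimpleGraph V} {𝒮 : Set (Set V)} {𝒞 : Set (Set V × Set V)}
  {P Q : Set V} (h : AreSides 𝒞 P Q) (C : CutFamily G 𝒮 𝒞)

include h

theorem symm : AreSides 𝒞 Q P := Or.symm h

include C

theorem inter_mem : P ∩ Q ∈ 𝒮 :=
  h.elim (fun h => C.inter_mem _ h) fun h => inter_comm Q P ▸ C.inter_mem _ h

theorem mem_of_notMem {v : V} (hv : v ∉ P) : v ∈ Q := by
  have hu : P ∪ Q = univ :=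
    h.elim (fun h => C.union_eq _ h) fun h => union_comm Q P ▸ C.union_eq _ h
  exact (hu ▸ mem_univ v : v ∈ P ∪ Q).resolve_left hv

theorem nonempty_diff : (P \ Q).Nonempty :=
  h.elim (fun h => C.nonempty_left _ h) fun h => C.nonempty_right _ h

theorem splits {a b : V} (ha : a ∉ Q) (hb : b ∉ P) : Splits G (P ∩ Q) a b := by
  refine ⟨fun h => ha h.2, fun h => hb h.1, fun hr => ?_⟩
  have ha' := h.symm.mem_of_notMem C ha
  have hb' := h.mem_of_notMem C hb
  rcases h with h | h
  · exact C.not_reachOff _ h a ⟨ha', ha⟩ b ⟨hb', hb⟩ hr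
  · exact C.not_reachOff _ h b ⟨hb', hb⟩ a ⟨ha', ha⟩ (inter_comm P Q ▸ hr.symm)

theorem notMem_of_mem_cmp {a b : V} (ha : a ∉ Q) (hb : b ∈ Cmp G (P ∩ Q) a) : b ∉ Q := fun hbQ =>
  (h.splits C ha fun hbP => ReachOff.notMem_right hb ⟨hbP, hbQ⟩).2.2 hb

/-- A vertex of the separator has a neighbour in each wing. -/
theorem exists_adj_notMem (H : SepSystem G 𝒮) {s : V} (hs : s ∈ P ∩ Q) :
    ∃ z, G.Adj s z ∧ z ∉ Q := by
  obtain ⟨p, -, hp⟩ := h.nonempty_diff C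
  obtain ⟨z, hz, hsz⟩ := H.full _ (h.inter_mem C) p (fun h => hp h.2) s hs
  exact ⟨z, hsz, h.notMem_of_mem_cmp C hp hz⟩

end AreSides

namespace HomSystem

variable {V : Type u} {E : V → V → Prop} {G : SimpleGraph V} {𝒮 : Set (Set V)}
  {𝒞 : Set (Set V × Set V)} {P Q : Set V} {s t : V} (H : HomSystem E G 𝒮)
  (C : CutFamily G 𝒮 𝒞)
include H C

theorem not_subset_inter (hi : OutTog (flip E) G 𝒮) (h : AreSides 𝒞 P Q)
    (hs : s ∈ P ∩ Q) : ¬ ∀ y, E s y → y ∈ P ∩ Q := by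
  intro hN
  obtain ⟨a, hsa, ha⟩ := h.exists_adj_notMem C H.toSepSystem hs
  obtain ⟨b, hsb, hb⟩ := h.symm.exists_adj_notMem C H.toSepSystem hs.symm
  exact hi s a b (((H.adj_iff _ _).1 hsa).resolve_left fun h => ha (hN a h).2)
    (((H.adj_iff _ _).1 hsb).resolve_left fun h => hb (hN b h).1)
    ⟨_, h.inter_mem C, h.splits C ha hb⟩

theorem subset_side (ho : OutTog E G 𝒮) (h : AreSides 𝒞 P Q) :
    insert s {y | E s y} ⊆ P ∨ insert s {y | E s y} ⊆ Q := by
  by_contra! hcon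
  simp only [not_subset] at hcon
  obtain ⟨⟨b, hb, hbP⟩, a, ha, haQ⟩ := hcon
  have hsp := h.splits C haQ hbP
  rcases ha with rfl | ha <;> rcases hb with rfl | hb
  · exact hsp.2.2 (.refl hsp.1)
  · exact hsp.2.2 (.of_adj (H.adj_of hb) hsp.1 hsp.2.1)
  · exact hsp.2.2 (.of_adj (H.adj_of' ha) hsp.1 hsp.2.1)
  · exact ho s a b ha hb ⟨_, h.inter_mem C, hsp⟩

/-- If `S` is closest to the out-neighbour `y` of `s`, then `S` is not separated from the
out-neighbours of `s` by any cut. -/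
theorem mem_side_of_closest (ho : OutTog E G 𝒮) (hi : OutTog (flip E) G 𝒮) {x y : V} {S : Set V}
    (hxs : E x s) (hsy : E s y) (hS : S ∈ 𝒮) (hsp : Splits G S x y)
    (hcl : ∀ S' ∈ 𝒮, Splits G S' x y → Cmp G S y ⊆ Cmp G S' y)
    (h : AreSides 𝒞 P Q) (hN : insert s {y | E s y} ⊆ P) (ht : t ∈ S) : t ∈ P := by
  by_contra htP
  have hsS : s ∈ S := hsp.mem_of_adj (H.adj_of' hxs) (H.adj_of hsy)
  have hd := h.inter_mem C
  have htd : t ∉ P ∩ Q := fun h => htP h.1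
  have hs : s ∈ P ∩ Q := by
    refine ⟨hN (mem_insert _ _), by_contra fun hsQ => ?_⟩
    have hsp := h.splits C hsQ htP
    exact hsp.2.2 (H.nested _ hd S hS s hsS t ht hsp.1 htd)
  obtain ⟨z, hsz, hzQ⟩ := h.exists_adj_notMem C H.toSepSystem hs
  obtain ⟨z', hsz', hz'P⟩ := h.symm.exists_adj_notMem C H.toSepSystem hs.symm
  have hz' : E z' s :=
    ((H.adj_iff _ _).1 hsz').resolve_left fun h => hz'P (hN (mem_insert_of_mem _ h))
  have hz : E s z := ((H.adj_iff _ _).1 hsz).resolve_right fun hz =>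
    hi s z z' hz hz' ⟨_, hd, h.splits C hzQ hz'P⟩
  have hzt := h.splits C hzQ htP
  have hav : ∀ r ∈ S, r ∉ Cmp G (P ∩ Q) z := fun r hr hrz => hzt.2.2
    (ReachOff.trans hrz (H.nested _ hd S hS r hr t ht (notMem_of_mem_cmp hrz) htd))
  have hzS : z ∉ S := fun h => hav z h (mem_cmp_self hzt.1)
  have hyK := mem_cmp_self (G := G) hsp.2.1
  by_cases hm : ∃ w ∈ P ∩ Q, w ∈ Cmp G S y
  · obtain ⟨w, hw, hwK⟩ := hm
    have hxK : x ∉ Cmp G S y := fun h => hsp.2.2 (ReachOff.symm h)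
    have hsub := H.cmp_subset_of_meets hd hw hwK hzt.1 hav
    refine H.not_ssubset_of_closest hxs hsy hz hcl hd
      ⟨fun hx => hxK (H.mem_cmp_of_meets hS hd hw hwK hx hsp.1), hzt.1,
        fun h => hxK (hsub h.symm)⟩ ⟨hsub, fun h => notMem_of_mem_cmp (h hwK) hw⟩
  · push Not at hm
    have hyd : y ∉ P ∩ Q := fun h => hm y h hyK
    have hyz : ReachOff G (P ∩ Q) y z := by
      by_contra hr
      exact ho s y z hsy hz ⟨_, hd, hyd, hzt.1, hr⟩
    have hyz' : ReachOff G S y z := by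
      by_contra hr
      exact ho s y z hsy hz ⟨_, hS, hsp.2.1, hzS, hr⟩
    have h1 : Cmp G S y ⊆ Cmp G (P ∩ Q) z := cmp_eq_of_mem hyz ▸ cmp_subset_cmp hm
    have h2 : Cmp G (P ∩ Q) z ⊆ Cmp G S y := cmp_eq_of_mem hyz' ▸ cmp_subset_cmp hav
    exact htd (H.subset_of_cmp_eq hS hsp.2.1 (h1.antisymm h2) ht)

theorem existsUnique_block (ho : OutTog E G 𝒮) (hi : OutTog (flip E) G 𝒮) (s : V) :
    ∃! X : Set V, IsCBlock 𝒞 X ∧ s ∈ X ∧ ∀ y, E s y → y ∈ X := by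
  let N : Set V := insert s {y | E s y}
  let X : Set V := {v | ∀ P Q, AreSides 𝒞 P Q → N ⊆ P → v ∈ P}
  have hNX : N ⊆ X := fun v hv P Q _ hP => hP hv
  have hnot : ∀ P Q, AreSides 𝒞 P Q → N ⊆ P → N ⊆ Q → False := fun P Q h hP hQ =>
    H.not_subset_inter C hi h ⟨hP (mem_insert s _), hQ (mem_insert s _)⟩ fun y hy =>
      ⟨hP (mem_insert_of_mem _ hy), hQ (mem_insert_of_mem _ hy)⟩
  have hsub : ∀ Y, BlockProp 𝒞 Y → N ⊆ Y → Y ⊆ X := by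
    intro Y hY hNY v hv P Q h hP
    have hYs : Y ⊆ P ∨ Y ⊆ Q := h.elim (fun h => (hY.1 _ h).1) fun h => (hY.1 _ h).1.symm
    exact hYs.elim (fun hYP => hYP hv) fun hYQ => (hnot P Q h hP (hNY.trans hYQ)).elim
  have hX : BlockProp 𝒞 X := by
    refine ⟨fun c hc => ⟨?_, fun h => ?_⟩, ?_⟩
    · exact (H.subset_side C ho (.inl hc : AreSides 𝒞 c.1 c.2)).imp
        (fun h v hv => hv _ _ (.inl hc) h) fun h v hv => hv _ _ (.inr hc) h
    · exact hnot c.1 c.2 (.inl hc) (hNX.trans h.1) (hNX.trans h.2)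
    · obtain ⟨x, hxs⟩ := H.rev.exists_out s
      obtain ⟨y, hsy⟩ := H.exists_out s
      obtain ⟨S, hS, hsp, hcl⟩ := H.exists_closest (H.mixSep x s y hxs hsy)
      obtain ⟨c, hc, hcS, hcK⟩ := C.exists_cut S hS y hsp.2.1
      refine ⟨c, hc, fun v hv => hv _ _ (.inl hc) ?_, fun t ht P Q h hP => ?_⟩
      · have hSc : S ⊆ c.1 := hcS ▸ inter_subset_left
        rintro z (rfl | hz)
        · exact hSc (hsp.mem_of_adj (H.adj_of' hxs) (H.adj_of hsy))
        · by_cases hzS : z ∈ S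
          · exact hSc hzS
          · have : z ∈ c.1 \ c.2 := by
              rw [hcK]
              by_contra hr
              exact ho s y z hsy hz ⟨S, hS, hsp.2.1, hzS, hr⟩
            exact this.1
      · exact H.mem_side_of_closest C ho hi hxs hsy hS hsp hcl h hP (hcS ▸ ht)
  refine ⟨X, ⟨⟨hX, fun X' hX' hb => (hsub X' hb (hNX.trans hX')).antisymm hX'⟩,
    hNX (mem_insert s _), fun y hy => hNX (mem_insert_of_mem _ hy)⟩, ?_⟩
  rintro Y ⟨⟨hY, hmax⟩, hsY, hyY⟩
  exact (hmax X (hsub Y hY (insert_subset hsY hyY)) hX).symm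

end HomSystem

section Connectivity

variable {V : Type u} {G : SimpleGraph V} {S C : Set V} {u v : V}

theorem reachOff_of_walk (w : G.Walk u v) (h : ∀ x ∈ w.support, x ∉ S) : ReachOff G S u v := by
  induction w with
  | nil => exact .refl (h _ (by simp))
  | cons ha p ih =>
    have := ih fun x hx => h x (by simp [hx])
    exact (ReachOff.of_adj ha (h _ (by simp)) this.1).trans this

theorem reachOff_of_induce_connected (hC : (G.induce C).Connected) (hS : ∀ x ∈ C, x ∉ S)
    (hu : u ∈ C) (hv : v ∈ C) : ReachOff G S u v := by
  obtain ⟨w⟩ := hC.preconnected ⟨u, hu⟩ ⟨v, hv⟩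
  let φ : G.induce C →g G := ⟨Subtype.val, id⟩
  refine reachOff_of_walk (w.map φ) fun x hx => ?_
  rw [SimpleGraph.Walk.support_map, List.mem_map] at hx
  obtain ⟨y, -, rfl⟩ := hx
  exact hS _ y.2

theorem induce_cmp_connected (hu : u ∉ S) : (G.induce (Cmp G S u)).Connected := by
  rw [SimpleGraph.connected_iff_exists_forall_reachable]
  refine ⟨⟨u, mem_cmp_self hu⟩, fun ⟨v, hv⟩ => ?_⟩
  obtain ⟨h, hv'⟩ := id hv
  induction hv' with
  | refl => rfl
  | @tail b c hb hc ih =>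
    have hbK : b ∈ Cmp G S u := ⟨h, hb⟩
    exact (ih hbK).trans (show (G.induce (Cmp G S u)).Adj ⟨b, hbK⟩ ⟨c, hv⟩ from hc.1).reachable

theorem ContainsEnd.mono {A B : Set V} (h : ContainsEnd G A) (hAB : A ⊆ B) : ContainsEnd G B :=
  let ⟨r, hr, hA⟩ := h
  ⟨r, hr, fun n => hAB (hA n)⟩

/-- A finite set leaves a tail of any ray in one component of its complement. -/
theorem ContainsEnd.exists_cmp {A : Set V} (h : ContainsEnd G A) (hS : S.Finite) :
    ∃ u ∈ A, u ∉ S ∧ ContainsEnd G (Cmp G S u) := by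
  obtain ⟨r, ⟨hinj, hadj⟩, hA⟩ := h
  obtain ⟨N, hN⟩ := (hS.preimage hinj.injOn).bddAbove
  have htail : ∀ n, r (n + (N + 1)) ∉ S := fun n hn => by
    have := hN hn
    omega
  refine ⟨r (N + 1), hA _, by simpa using htail 0, fun n => r (n + (N + 1)), ⟨fun i j h => ?_,
    fun n => ?_⟩, fun n => ?_⟩
  · have := hinj h
    omega
  · have := hadj (n + (N + 1))
    rwa [show n + (N + 1) + 1 = n + 1 + (N + 1) by omega] at this
  · induction n with
    | zero => simpa using mem_cmp_self (G := G) (htail 0)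
    | succ n ih =>
      refine mem_cmp_of_adj ih ?_ (htail _)
      have := hadj (n + (N + 1))
      rwa [show n + (N + 1) + 1 = n + 1 + (N + 1) by omega] at this

end Connectivity

section Separation

variable {V : Type u} {G : SimpleGraph V} {c : Set V × Set V} {a b t : V}

theorem IsSeparation.swap (h : IsSeparation G c) : IsSeparation G c.swap :=
  ⟨union_comm c.1 c.2 ▸ h.1, fun x y hxy => (h.2 x y hxy).symm⟩

theorem IsSeparation.cmp_subset (h : IsSeparation G c) (ha : a ∈ c.1 \ c.2) :
    Cmp G (c.1 ∩ c.2) a ⊆ c.1 \ c.2 := fun b hb => by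
  refine ReachOff.mem_of_closed hb ha fun p q hp hpq hq => ?_
  have := (h.2 p q hpq).resolve_right fun h => hp.2 h.1
  exact ⟨this.2, fun h => hq ⟨this.2, h⟩⟩

theorem IsSeparation.cmp_subset_right (h : IsSeparation G c) (ha : a ∈ c.2 \ c.1) :
    Cmp G (c.1 ∩ c.2) a ⊆ c.2 \ c.1 := by
  rw [inter_comm]
  exact h.swap.cmp_subset ha

theorem IsSeparation.mem_wings (h : IsSeparation G c) (ha : a ∉ c.1 ∩ c.2) :
    a ∈ c.1 \ c.2 ∨ a ∈ c.2 \ c.1 := by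
  have : a ∈ c.1 ∪ c.2 := h.1 ▸ mem_univ a
  simp only [mem_union, mem_inter_iff, mem_sdiff] at *
  tauto

theorem IsEssential.cmp_eq (h : IsEssential G c) (ha : a ∈ c.1 \ c.2) :
    Cmp G (c.1 ∩ c.2) a = c.1 \ c.2 :=
  (h.1.cmp_subset ha).antisymm fun _ hb =>
    reachOff_of_induce_connected h.2.2.2.2.1 (fun _ hx hx' => hx.2 hx'.2) ha hb

/-- Every vertex of the separator of an essential separation has a neighbour in its first wing. -/
theorem IsEssential.exists_adj (h : IsEssential G c) (ht : t ∈ c.1 ∩ c.2) :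
    ∃ a ∈ c.1 \ c.2, G.Adj t a := by
  by_contra! hcon
  refine h.2.2.2.2.2 ((c.1 ∩ c.2) \ {t}) ⟨sdiff_subset, fun h => (h ht).2 rfl⟩ fun a ha b hb w => ?_
  by_contra! hw
  have hr : ReachOff G ((c.1 ∩ c.2) \ {t}) a b := reachOff_of_walk w hw
  refine hb.2 (hr.mem_of_closed ha fun p q hp hpq hq => ?_).1
  have hq' := (h.1.2 p q hpq).resolve_right fun h => hp.2 h.1
  refine ⟨hq'.2, fun hq2 => ?_⟩
  by_cases hqt : q = t
  · exact hcon p hp (hqt ▸ hpq.symm)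
  · exact hq ⟨⟨hq'.2, hq2⟩, hqt⟩

end Separation

namespace IsBasic

variable {V : Type u} {G : SimpleGraph V} {𝒞 : Set (Set V × Set V)} {c d : Set V × Set V}
  {S : Set V} {s t u v x : V} (h : IsBasic G 𝒞)
include h

theorem isEssential (hc : c ∈ 𝒞) : IsEssential G c := h.1.2.1 c hc

/-- The complement of a component of the complement of a separator contains an end. -/
theorem containsEnd_compl (hc : c ∈ 𝒞) (hu : u ∉ c.1 ∩ c.2) :
    ContainsEnd G (Cmp G (c.1 ∩ c.2) u)ᶜ := by
  obtain ⟨h1, h2, -⟩ := h.2.2.2.2.2 c hc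
  have hs := (h.isEssential hc).1
  rcases hs.mem_wings hu with hu | hu
  · exact h2.mono fun x hx hx' => (hs.cmp_subset hu hx').2 hx
  · exact h1.mono fun x hx hx' => (hs.cmp_subset_right hu hx').2 hx

theorem exists_adj_of_containsEnd (hc : c ∈ 𝒞) (hu : u ∉ c.1 ∩ c.2)
    (hK : ContainsEnd G (Cmp G (c.1 ∩ c.2) u)) (ht : t ∈ c.1 ∩ c.2) :
    ∃ v ∈ Cmp G (c.1 ∩ c.2) u, G.Adj t v := by
  by_contra! hcon
  have hfin := (h.isEssential hc).2.1
  set S := c.1 ∩ c.2 with hS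
  set K := Cmp G S u with hKdef
  have hinter : (K ∪ S \ {t}) ∩ Kᶜ = S \ {t} := by
    rw [union_inter_distrib_right, inter_compl_self, empty_union, inter_eq_left]
    exact fun x hx hxK => notMem_of_mem_cmp hxK hx.1
  have hadj : ∀ x y, G.Adj x y → x ∈ K → y ∈ K ∪ S \ {t} := by
    intro x y hxy hx
    by_cases hy : y ∈ S
    · exact .inr ⟨hy, fun hyt => hcon x hx (by rw [← (show y = t from hyt)]; exact hxy.symm)⟩
    · exact .inl (mem_cmp_of_adj hx hxy hy)
  refine (h.2.2.2.2.2 c hc).2.2 ⟨(K ∪ S \ {t}, Kᶜ), ⟨?_, fun x y hxy => ?_⟩, ?_, ?_,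
    hK.mono subset_union_left, h.containsEnd_compl hc hu⟩
  · exact eq_univ_of_forall fun x => (em (x ∈ K)).imp .inl id
  · by_cases hx : x ∈ K
    · exact .inl ⟨.inl hx, hadj x y hxy hx⟩
    · by_cases hy : y ∈ K
      · exact .inl ⟨hadj y x hxy.symm hy, .inl hy⟩
      · exact .inr ⟨hx, hy⟩
  · rw [hinter]
    exact hfin.sdiff
  · rw [hinter]
    exact ncard_sdiff_singleton_lt_of_mem ht hfin

/-- For two cuts, some component of the complement of the first separator contains an end and
avoids the second separator; moreover the first separator lies on one side of the second cut. -/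
theorem exists_cmp_avoiding (hc : c ∈ 𝒞) (hd : d ∈ 𝒞) :
    (∃ u, u ∉ c.1 ∩ c.2 ∧ ContainsEnd G (Cmp G (c.1 ∩ c.2) u) ∧
      (∀ t ∈ c.1 ∩ c.2, ∃ v ∈ Cmp G (c.1 ∩ c.2) u, G.Adj t v) ∧
      ∀ w ∈ d.1 ∩ d.2, w ∉ Cmp G (c.1 ∩ c.2) u) ∧ (c.1 ∩ c.2 ⊆ d.1 ∨ c.1 ∩ c.2 ⊆ d.2) := by
  obtain ⟨i, j, -, hij⟩ := h.2.2.1 c hc d hd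
  have hs := (h.isEssential hc).1
  have hfin := (h.isEssential hc).2.1
  obtain ⟨h1, h2, -⟩ := h.2.2.2.2.2 c hc
  constructor
  · cases i
    · obtain ⟨u, hu, huS, hK⟩ := h1.exists_cmp hfin
      refine ⟨u, huS, hK, fun t => h.exists_adj_of_containsEnd hc huS hK, fun w hw hwK => ?_⟩
      exact (hs.cmp_subset ⟨hu, fun hu' => huS ⟨hu, hu'⟩⟩ hwK).2 (hij (.inr hw)).1
    · obtain ⟨u, hu, huS, hK⟩ := h2.exists_cmp hfin
      refine ⟨u, huS, hK, fun t => h.exists_adj_of_containsEnd hc huS hK, fun w hw hwK => ?_⟩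
      exact (hs.cmp_subset_right ⟨hu, fun hu' => huS ⟨hu', hu⟩⟩ hwK).2 (hij (.inr hw)).1
  · cases j
    · exact .inr fun w hw => (hij (.inl hw)).2
    · exact .inl fun w hw => (hij (.inl hw)).2

theorem exists_mem_separator (hconn : G.Connected) (htrans : ∀ a b, ∃ φ : G ≃g G, φ a = b)
    (v : V) : ∃ c ∈ 𝒞, v ∈ c.1 ∩ c.2 := by
  obtain ⟨c, hc⟩ := h.1.1
  obtain ⟨hs, -, ⟨a, ha⟩, ⟨b, hb⟩, -⟩ := h.isEssential hc
  obtain ⟨t, ht⟩ : (c.1 ∩ c.2).Nonempty := by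
    by_contra! hne
    obtain ⟨w⟩ := hconn.preconnected a b
    have hr : ReachOff G (c.1 ∩ c.2) a b := reachOff_of_walk w fun x _ => by simp [hne]
    exact hb.2 (hs.cmp_subset ha hr).1
  obtain ⟨φ, rfl⟩ := htrans t v
  exact ⟨_, h.2.2.2.1 φ c hc, mem_image_of_mem φ ht.1, mem_image_of_mem φ ht.2⟩

theorem containsEnd_cmp (hcov : ∀ v, ∃ c ∈ 𝒞, v ∈ c.1 ∩ c.2) (hc : c ∈ 𝒞)
    (hu : u ∉ c.1 ∩ c.2) : ContainsEnd G (Cmp G (c.1 ∩ c.2) u) := by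
  obtain ⟨d, hd, hud⟩ := hcov u
  obtain ⟨⟨w, -, hend, hfull, hav⟩, -⟩ := h.exists_cmp_avoiding hd hc
  obtain ⟨p, hp, hup⟩ := hfull u hud
  have hsub := cmp_subset_cmp hav
  have hpu : p ∈ Cmp G (c.1 ∩ c.2) u :=
    mem_cmp_of_adj (mem_cmp_self hu) hup (hav p · hp)
  rw [← cmp_eq_of_mem hpu, cmp_eq_of_mem (hsub hp)]
  exact hend.mono hsub

theorem eq_of_unique_neighbour (hcov : ∀ v, ∃ c ∈ 𝒞, v ∈ c.1 ∩ c.2) (hc : c ∈ 𝒞)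
    (hs : s ∉ c.1 ∩ c.2) {x x' : V} (hx : x ∈ c.1 ∩ c.2) (hx' : x' ∈ c.1 ∩ c.2)
    (hxs : ∀ y ∈ Cmp G (c.1 ∩ c.2) s, G.Adj x y → y = s)
    (hx's : ∀ y ∈ Cmp G (c.1 ∩ c.2) s, G.Adj x' y → y = s) : x = x' := by
  by_contra hne
  have hend := h.containsEnd_cmp hcov hc hs
  have hcompl := h.containsEnd_compl hc hs
  have hfin := (h.isEssential hc).2.1
  have hmin := (h.2.2.2.2.2 c hc).2.2
  unfold sepOrder at hmin
  set S := c.1 ∩ c.2 with hS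
  set K := Cmp G S s with hKdef
  have hinter : (K ∪ S \ {x, x'}) ∩ insert s Kᶜ ⊆ insert s (S \ {x, x'}) := by
    rintro y ⟨hy | hy, hy' | hy'⟩
    exacts [.inl hy', (hy' hy).elim, .inr hy, .inr hy]
  have hle : (insert s (S \ {x, x'})).ncard < S.ncard := by
    have h1 := ncard_insert_le s (S \ {x, x'})
    have h2 := ncard_sdiff_add_ncard_of_subset (pair_subset hx hx') hfin
    rw [ncard_pair hne] at h2
    omega
  have hfin' : (insert s (S \ {x, x'})).Finite := hfin.sdiff.insert s
  have hadj : ∀ p q, G.Adj p q → p ∈ K → (q ∈ K ∪ S \ {x, x'} ∨ (p = s ∧ q ∈ Kᶜ)) := by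
    intro p q hpq hp
    by_cases hq : q ∈ S
    · by_cases hqx : q ∈ ({x, x'} : Set V)
      · refine .inr ⟨?_, fun hqK => notMem_of_mem_cmp hqK hq⟩
        rcases hqx with rfl | rfl
        exacts [hxs p hp hpq.symm, hx's p hp hpq.symm]
      · exact .inl (.inr ⟨hq, hqx⟩)
    · exact .inl (.inl (mem_cmp_of_adj hp hpq hq))
  refine hmin ⟨(K ∪ S \ {x, x'}, insert s Kᶜ), ⟨?_, fun p q hpq => ?_⟩, hfin'.subset hinter,
    (ncard_le_ncard hinter hfin').trans_lt hle, hend.mono subset_union_left,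
    hcompl.mono (subset_insert _ _)⟩
  · exact eq_univ_of_forall fun y => (em (y ∈ K)).imp .inl .inr
  · by_cases hp : p ∈ K
    · rcases hadj p q hpq hp with hq | ⟨hps, hq⟩
      exacts [.inl ⟨.inl hp, hq⟩, .inr ⟨.inl hps, .inr hq⟩]
    · by_cases hq : q ∈ K
      · rcases hadj q p hpq.symm hq with hp' | ⟨hqs, hp'⟩
        exacts [.inl ⟨hp', .inl hq⟩, .inr ⟨.inr hp', .inl hqs⟩]
      · exact .inr ⟨.inr hp, .inr hq⟩

theorem sepSystem (hconn : G.Connected) (htrans : ∀ a b, ∃ φ : G ≃g G, φ a = b) :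
    SepSystem G {S | IsSeparatorOf 𝒞 S} where
  finite := by
    rintro _ ⟨c, hc, rfl⟩
    exact (h.isEssential hc).2.1
  ncard_eq := by
    rintro _ ⟨c, hc, rfl⟩ _ ⟨d, hd, rfl⟩
    exact (not_lt.1 (h.2.1 d hd c hc)).antisymm (not_lt.1 (h.2.1 c hc d hd))
  full := by
    rintro _ ⟨c, hc, rfl⟩ u hu t ht
    have hcov := h.exists_mem_separator hconn htrans
    exact h.exists_adj_of_containsEnd hc hu (h.containsEnd_cmp hcov hc hu) ht
  exists_far := by
    rintro _ ⟨c, hc, rfl⟩ u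
    obtain ⟨hs, -, ⟨a, ha⟩, ⟨b, hb⟩, -⟩ := h.isEssential hc
    by_cases hu : u ∈ c.1 \ c.2
    · exact ⟨b, fun h => hb.2 h.1, fun h => hb.2 (hs.cmp_subset hu h).1⟩
    · exact ⟨a, fun h => ha.2 h.2, fun h => hu (hs.cmp_subset ha (ReachOff.symm h))⟩
  nested := by
    rintro _ ⟨c, hc, rfl⟩ _ ⟨d, hd, rfl⟩ a ha b hb hac hbc
    obtain ⟨⟨u, -, -, hfull, hav⟩, -⟩ := h.exists_cmp_avoiding hd hc
    obtain ⟨p, hp, hap⟩ := hfull a ha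
    obtain ⟨q, hq, hbq⟩ := hfull b hb
    have hsub := cmp_subset_cmp hav
    have hpu := ReachOff.symm (hsub hp)
    exact (ReachOff.of_adj hap hac hpu.1).trans (hpu.trans (ReachOff.trans (hsub hq)
      (.of_adj hbq.symm (notMem_of_mem_cmp (hsub hq)) hbc)))
  image_mem := by
    rintro φ _ ⟨c, hc, rfl⟩
    exact ⟨_, h.2.2.2.1 φ c hc, (image_inter φ.injective).symm⟩
  cover v :=
    let ⟨c, hc, hv⟩ := h.exists_mem_separator hconn htrans v
    ⟨_, ⟨c, hc, rfl⟩, hv⟩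
  tight := by
    rintro _ ⟨c, hc, rfl⟩ s hs x hx x' hx' h1 h2
    exact (h.eq_of_unique_neighbour (h.exists_mem_separator hconn htrans) hc hs hx hx' h1 h2).symm

/-- Every component of the complement of a separator contains the first wing of a cut. -/
theorem exists_wing_subset (H : SepSystem G {S | IsSeparatorOf 𝒞 S}) (hc : c ∈ 𝒞)
    (hv : v ∉ c.1 ∩ c.2) : ∃ d ∈ 𝒞, d.1 \ d.2 ⊆ Cmp G (c.1 ∩ c.2) v := by
  obtain ⟨_, ⟨d, hd, rfl⟩, hvd⟩ := H.cover v
  have hed := h.isEssential hd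
  have hvK := mem_cmp_self (G := G) hv
  have hmem : ∀ u, u ∉ d.1 ∩ d.2 → (∀ w ∈ c.1 ∩ c.2, w ∉ Cmp G (d.1 ∩ d.2) u) →
      Cmp G (d.1 ∩ d.2) u ⊆ Cmp G (c.1 ∩ c.2) v := fun u hu hav =>
    H.cmp_subset_of_meets ⟨d, hd, rfl⟩ hvd hvK hu hav
  obtain ⟨a, ha⟩ := hed.2.2.1
  rcases (h.exists_cmp_avoiding hc hd).2 with hS | hS
  · obtain ⟨e, he, hed2⟩ := h.1.2.2.1 d hd
    have hee := h.isEssential he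
    have hsub : e.1 \ e.2 ⊆ d.2 \ d.1 := by
      refine fun p hp => ⟨hed2 hp.1, fun hp1 => ?_⟩
      obtain ⟨q, hq, hpq⟩ := hed.exists_adj ⟨hp1, hed2 hp.1⟩
      exact hq.2 (hed2 ((hee.1.2 p q hpq).resolve_right fun h => hp.2 h.1).2)
    obtain ⟨p, hp⟩ := hee.2.2.1
    have hpd : p ∉ d.1 ∩ d.2 := fun h => (hsub hp).2 h.1
    refine ⟨e, he, fun q hq => hmem p hpd (fun w hw hwK => ?_) ?_⟩
    · exact (hed.1.cmp_subset_right (hsub hp) hwK).2 (hS hw)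
    · exact reachOff_of_induce_connected hee.2.2.2.2.1 (fun x hx hx' => (hsub hx).2 hx'.1) hp hq
  · refine ⟨d, hd, hed.cmp_eq ha ▸ hmem a (fun h => ha.2 h.2) fun w hw hwK => ?_⟩
    exact (hed.1.cmp_subset ha hwK).2 (hS hw)

theorem cutFamily (H : SepSystem G {S | IsSeparatorOf 𝒞 S}) :
    CutFamily G {S | IsSeparatorOf 𝒞 S} 𝒞 where
  inter_mem c hc := ⟨c, hc, rfl⟩
  union_eq c hc := (h.isEssential hc).1.1
  nonempty_left c hc := (h.isEssential hc).2.2.1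
  nonempty_right c hc := (h.isEssential hc).2.2.2.1
  not_reachOff c hc a ha b hb hr := hb.2 ((h.isEssential hc).1.cmp_subset ha hr).1
  exists_cut := by
    rintro _ ⟨c, hc, rfl⟩ u hu
    have hec := h.isEssential hc
    have hS : c.1 ∩ c.2 ∈ {S | IsSeparatorOf 𝒞 S} := ⟨c, hc, rfl⟩
    rcases hec.1.mem_wings hu with huw | huw
    · exact ⟨c, hc, rfl, (hec.cmp_eq huw).symm⟩
    have hsub := hec.1.cmp_subset_right huw
    have hcomp : IsCompOf G (Cmp G (c.1 ∩ c.2) u) (c.2 \ c.1) := by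
      refine ⟨⟨u, mem_cmp_self hu⟩, hsub, induce_cmp_connected hu, fun C' h1 h2 h3 => ?_⟩
      refine Subset.antisymm (fun q hq => ?_) h1
      exact reachOff_of_induce_connected h3 (fun x hx hx' => (h2 hx).2 hx'.1)
        (h1 (mem_cmp_self hu)) hq
    have hmem := h.1.2.2.2.1 c hc _ hcomp (h.exists_wing_subset H hc hu)
    have hN : Nbhd G (Cmp G (c.1 ∩ c.2) u) = c.1 ∩ c.2 := by
      ext t
      refine ⟨fun ⟨htK, p, hp, hpt⟩ => by_contra fun ht => htK (mem_cmp_of_adj hp hpt ht),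
        fun ht => ⟨fun htK => notMem_of_mem_cmp htK ht, ?_⟩⟩
      obtain ⟨p, hp, htp⟩ := H.full _ hS u hu t ht
      exact ⟨p, hp, htp.symm⟩
    rw [hN] at hmem
    set S := c.1 ∩ c.2
    set K := Cmp G S u
    have hK : ∀ p ∈ K, p ∉ (K ∪ S)ᶜ ∪ Nbhd G (K ∪ S)ᶜ := by
      rintro p hp (hp' | ⟨-, q, hq, hqp⟩)
      · exact hp' (.inl hp)
      · exact hq ((em (q ∈ S)).elim .inr fun hqS => .inl (mem_cmp_of_adj hp hqp.symm hqS))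
    have hSN : ∀ t ∈ S, t ∈ (K ∪ S)ᶜ ∪ Nbhd G (K ∪ S)ᶜ := by
      intro t ht
      obtain ⟨w, hw, hwK⟩ := H.exists_far S hS u
      obtain ⟨q, hq, htq⟩ := H.full S hS w hw t ht
      refine .inr ⟨fun h => h (.inr ht), q, ?_, htq.symm⟩
      rintro (hqK | hqS)
      · exact hwK (ReachOff.trans hqK (ReachOff.symm hq))
      · exact notMem_of_mem_cmp hq hqS
    refine ⟨_, hmem, ?_, ?_⟩
    · ext p
      refine ⟨fun hp => hp.1.resolve_left fun hpK => hK p hpK hp.2, fun hp => ⟨.inr hp, hSN p hp⟩⟩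
    · ext p
      refine ⟨fun hp => hp.1.resolve_right fun hpS => hp.2 (hSN p hpS),
        fun hp => ⟨.inl hp, hK p hp⟩⟩

end IsBasic

section Digraph

variable {V : Type u} {E : V → V → Prop}

theorem ug_adj (hD : IsDigraph E) (x y : V) : (UG E).Adj x y ↔ E x y ∨ E y x := by
  rw [UG, SimpleGraph.fromRel_adj, and_iff_right_iff_imp]
  rintro h rfl
  exact hD.1 x (h.elim id id)

/-- In a triangle-free C-homogeneous digraph, isomorphisms between finite induced stars extend to
automorphisms. -/
theorem DigraphCHom.exists_extend_star (hhom : DigraphCHom E) (hD : IsDigraph E)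
    (htf : ¬ HasTriangle E) {n : ℕ} {c c' : V} {f g : Fin n → V} (hf : Function.Injective f)
    (hg : Function.Injective g) (hcf : ∀ i, (UG E).Adj c (f i)) (hcg : ∀ i, (UG E).Adj c' (g i))
    (hfg : ∀ i, E c (f i) ↔ E c' (g i)) :
    ∃ ψ : UG E ≃g UG E, (∀ x y, E (ψ x) (ψ y) ↔ E x y) ∧ ψ c = c' ∧ ∀ i, ψ (f i) = g i := by
  let F : Option (Fin n) → V := fun o => o.elim c f
  let F' : Option (Fin n) → V := fun o => o.elim c' g
  have inj : ∀ {c : V} {f : Fin n → V}, Function.Injective f → (∀ i, (UG E).Adj c (f i)) →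
      Function.Injective fun o : Option (Fin n) => o.elim c f := by
    rintro c f hf hcf (_ | i) (_ | j) h
    exacts [rfl, ((hcf j).ne h).elim, ((hcf i).ne h.symm).elim, congrArg some (hf h)]
  have leaf : ∀ {c : V} {f : Fin n → V}, (∀ i, (UG E).Adj c (f i)) → ∀ i j, ¬ E (f i) (f j) :=
    fun hcf i j h => htf ⟨_, _, _, hcf i, (ug_adj hD _ _).2 (.inl h), hcf j⟩
  have opp : ∀ {x y : V}, (UG E).Adj x y → (E y x ↔ ¬ E x y) := fun h =>
    ⟨fun h' => hD.2 _ _ h', ((ug_adj hD _ _).1 h).resolve_left⟩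
  have hF : Function.Injective F := inj hf hcf
  have hF' : Function.Injective F' := inj hg hcg
  have hE : ∀ o o', E (F o) (F o') ↔ E (F' o) (F' o') := by
    rintro (_ | i) (_ | j)
    · exact iff_of_false (hD.1 _) (hD.1 _)
    · exact hfg j
    · exact (opp (hcf i)).trans ((not_congr (hfg i)).trans (opp (hcg i)).symm)
    · exact iff_of_false (leaf hcf i j) (leaf hcg i j)
  obtain ⟨ψ, hψ, hψF⟩ := hhom (range F) (range F') (finite_range F) (finite_range F') (by
      rw [SimpleGraph.connected_iff_exists_forall_reachable]
      refine ⟨⟨F none, mem_range_self _⟩, ?_⟩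
      rintro ⟨_, _ | i, rfl⟩
      · rfl
      · exact SimpleGraph.Adj.reachable (hcf i))
    ((Equiv.ofInjective F hF).symm.trans (Equiv.ofInjective F' hF')) (by
      rintro ⟨_, o, rfl⟩ ⟨_, o', rfl⟩
      simpa [Equiv.ofInjective_symm_apply] using hE o o')
  have hψ' : ∀ o, ψ (F o) = F' o := fun o => by
    simpa [Equiv.ofInjective_symm_apply] using hψF ⟨F o, mem_range_self o⟩
  exact ⟨⟨ψ, fun {a b} => by rw [ug_adj hD, ug_adj hD, hψ, hψ]⟩, hψ, hψ' none,
    fun i => hψ' (some i)⟩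

end Digraph
/-- For a vertex `s` of a separator of a basic cut system of a connected
C-homogeneous triangle-free digraph with more than one end that is not a tree:
there is exactly one block containing `s` and all its out-neighbours, exactly one
block containing `s` and all its in-neighbours, and `s` has more than one
out-neighbour and more than one in-neighbour. -/
theorem stmt_5 {V : Type u} (E : V → V → Prop) (hD : IsDigraph E)
    (hconn : (UG E).Connected) (hhom : DigraphCHom E) (htf : ¬ HasTriangle E)
    (hnt : ¬ (UG E).IsTree) (hends : MoreThanOneEnd (UG E))
    (𝒞 : Set (Set V × Set V)) (h𝒞 : IsBasic (UG E) 𝒞)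
    (S : Set V) (hS : IsSeparatorOf 𝒞 S) (s : V) (hs : s ∈ S) :
    (∃! X : Set V, IsCBlock 𝒞 X ∧ s ∈ X ∧ ∀ y, E s y → y ∈ X) ∧
    (∃! X : Set V, IsCBlock 𝒞 X ∧ s ∈ X ∧ ∀ y, E y s → y ∈ X) ∧
    (∃ y z : V, y ≠ z ∧ E s y ∧ E s z) ∧
    (∃ y z : V, y ≠ z ∧ E y s ∧ E z s) := by
  have hstar := fun n c c' f g => hhom.exists_extend_star hD htf (n := n) (c := c) (c' := c')
    (f := f) (g := g)
  have htrans : ∀ a b, ∃ φ : UG E ≃g UG E, φ a = b := fun a b =>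
    let ⟨φ, _, h, _⟩ := hstar 0 a b ![] ![] (Function.injective_of_subsingleton _)
      (Function.injective_of_subsingleton _) (fun i => i.elim0) (fun i => i.elim0)
      (fun i => i.elim0)
    ⟨φ, h⟩
  have hsys := h𝒞.sepSystem hconn htrans
  have H : HomSystem E (UG E) {S | IsSeparatorOf 𝒞 S} :=
    { hsys with adj_iff := ug_adj hD, asymm := hD.2, connected := hconn, star := hstar }
  have C := h𝒞.cutFamily hsys
  have ho := H.outTog hnt
  have hi := H.rev.outTog hnt
  exact ⟨H.existsUnique_block C ho hi s, H.rev.existsUnique_block C hi ho s,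
    H.exists_two_out hnt s, H.rev.exists_two_out hnt s⟩
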